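/- Let k be a field of characteristic 2 containing a primitive cube root of unity, and let G = Q_8 be the quaternion group of order 8. Suppose M_0, M_1, M_2, M_3 are finite-dimensional kG-modules such that M_0 is the trivial module k and, for each i = 0, 1, 2, there is a short exact sequence 0 → M_{i+1} → P_i → M_i → 0 of kG-modules with P_i finite-dimensional projective. Then the M_i are pairwise not stably isomorphic endotrivial modules, and there exists a finite-dimensional endotrivial kG-module L such that: (i) L ⊗ L is stably isomorphic to k; (ii) L is not stably isomorphic to any M_i; and (iii) every endotrivial kG-module is stably isomorphic to M_i or to M_i ⊗ L for some i ∈ {0,1,2,3}. In particular, the group of endotrivial modules of Q_8 (the Picard group of StMod(kQ_8)) is isomorphic to C_4 ⊕ C_2. -/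

import Mathlib

open CategoryTheory CategoryTheory.Limits MonoidalCategory

/-- A representation `M` of `G` over `k` is *endotrivial* if it is finite-dimensional over `k`
and its `k`-linear endomorphism module, with the conjugation `G`-action, is isomorphic to the
direct sum of the trivial representation `k` and a projective. -/
def IsEndotrivial {k G : Type} [Field k] [Group G] (M : Rep k G) : Prop :=
  FiniteDimensional k M.V ∧
    ∃ P : Rep k G, Projective P ∧
      Nonempty (Rep.of (M.ρ.linHom M.ρ) ≅ Rep.trivial k G k ⊞ P)

/-- Two representations are *stably isomorphic* if they become isomorphic after adding
projective summands. -/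
def IsStablyIso {k G : Type} [Field k] [Group G] (M N : Rep k G) : Prop :=
  ∃ P Q : Rep k G, Projective P ∧ Projective Q ∧ Nonempty (M ⊞ P ≅ N ⊞ Q)


set_option linter.unusedSectionVars false
set_option linter.unusedSimpArgs false

namespace QE

/-- The operators `x = θ - 1`, `y = τ - 1` of a `kQ₈`-module. -/
structure QX {k V : Type} [Field k] [AddCommGroup V] [Module k V] (x y : V →ₗ[k] V) : Prop where
  hyy : ∀ v, y (y v) = x (x v)
  hyx : ∀ v, y (x v) = x (y v) + x (x (v + x v + y v + x (y v)))
  h4 : ∀ v, x (x (x (x v))) = 0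

section core
variable {k V : Type} [Field k] [CharP k 2] [AddCommGroup V] [Module k V] {x y : V →ₗ[k] V}

/-- the standing hypotheses of the core computation -/
structure Core (x y : V →ₗ[k] V) (w : V) : Prop extends QX x y where
  N : ∀ v, x (x (x (y v))) = 0
  K : ∀ v, x (x v) = 0 → ∃ u, ∃ μ : k, v = x (x u) + μ • w
  xw : x w = 0
  Sx : ∀ v, x (x (x v)) = 0 → ∃ u, x (x v) = x (x (x u))

lemma two0 : (2 : k) = 0 := CharTwo.two_eq_zero

lemma Core.Qy {w : V} (h : Core x y w) {q : V} (hq : x (x (x q)) = 0) : x (x (y q)) = 0 := by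
  obtain ⟨u, hu⟩ := h.Sx q hq
  have e1 : y (x (x q)) = x (x (y q)) := by
    rw [← h.hyy, ← h.hyy]
  rw [← e1, hu]
  simp only [h.hyx, map_add, h.h4, h.N, map_zero, add_zero]

lemma Core.F3 {w : V} (h : Core x y w) (hxyw : x (y w) = 0) {v u : V}
    (hu : x (x (y v)) = x (x (x u))) : x (x (y u)) = x (x (x u)) + x (x (x v)) := by
  have h0 : x (x (y v - x u)) = 0 := by simp [hu]
  obtain ⟨b, l, hb⟩ := h.K _ h0
  have hb' : y v = x u + x (x b) + l • w := by rw [add_assoc, ← hb]; abel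
  have e := congrArg (fun t => x (y t)) hb'
  simp only [map_add, map_smul, h.hyy, h.hyx, h.h4, h.N, h.xw, hxyw, smul_zero, add_zero, map_zero] at e
  linear_combination (norm := (match_scalars <;> grind)) -e + (two0 (k := k)) • (x (x (x u)) ) + (two0 (k := k)) • (x (x (y u)) )

lemma Core.F4 {w : V} (h : Core x y w) (hxyw : x (y w) = 0) {o : k} (ho : o * o = o + 1) (v : V) :
    ∃ v1 v2, v = v1 + v2 ∧ x (x (y v1)) = o • x (x (x v1)) ∧
      x (x (y v2)) = (o + 1) • x (x (x v2)) := by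
  obtain ⟨u, hu⟩ := h.Sx (y v) (h.N v)
  have h3 := h.F3 hxyw hu
  refine ⟨u + (o + 1) • v, u + o • v, ?_, ?_, ?_⟩
  · linear_combination (norm := (match_scalars <;> grind)) -(two0 (k := k)) • (u + o • v)
  · simp only [map_add, map_smul, hu, h3]
    linear_combination (norm := (match_scalars <;> grind)) -ho • x (x (x v)) + (two0 (k := k)) • (x (x (x u))-o • x (x (x v)))
  · simp only [map_add, map_smul, hu, h3]
    linear_combination (norm := (match_scalars <;> grind)) -ho • x (x (x v)) -  (two0 (k := k)) • (o • x (x (x v)))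

lemma Core.split {w : V} (h : Core x y w) {o : k} {v1 v2 : V}
    (h1 : x (x (y v1)) = o • x (x (x v1))) (h2 : x (x (y v2)) = (o + 1) • x (x (x v2)))
    (h0 : x (x (x (v1 + v2))) = 0) : x (x (x v1)) = 0 ∧ x (x (x v2)) = 0 := by
  have hq := h.Qy h0
  simp only [map_add, h1, h2] at h0 hq
  have e2 : x (x (x v2)) = 0 := by linear_combination (norm := (match_scalars <;> grind)) hq - o • h0
  refine ⟨by simpa [e2] using h0, e2⟩

lemma Core.F5 {w c1 c2 : V} (h : Core x y w) (hyw : y w = x (x (x (c1 + c2))))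
    {o : k} (ho : o * o = o + 1)
    (hc1 : x (x (y c1)) = o • x (x (x c1))) (hc2 : x (x (y c2)) = (o + 1) • x (x (x c2)))
    {v : V} (hv : x (x (y v)) = o • x (x (x v))) :
    ∃ (l : k) (b1 b2 : V), y v = o • x v + l • w + x (x b1) + x (x b2) ∧
      x (x (y b1)) = o • x (x (x b1)) ∧ x (x (x v)) = l • x (x (x c1)) ∧
      x (x (x b2)) = l • x (x (x c2)) := by
  have hxyw : x (y w) = 0 := by rw [hyw, h.h4]
  have h0 : x (x (y v - o • x v)) = 0 := by simp [hv]
  obtain ⟨b, l, hb⟩ := h.K _ h0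
  obtain ⟨b1, b2, rfl, hb1, hb2⟩ := h.F4 hxyw ho b
  have hb' : y v = o • x v + l • w + x (x b1) + x (x b2) := by
    rw [map_add, map_add] at hb
    linear_combination (norm := (match_scalars <;> grind)) hb
  have e := congrArg (fun t => y t) hb'
  have e2 := congrArg (fun t => x t) hb'
  simp only [map_add, map_smul, h.hyy, h.hyx, h.h4, h.N, h.xw, smul_zero, add_zero, map_zero] at e e2
  rw [hyw, hv, hb1, hb2] at e
  simp only [map_add] at e
  have key : x (x (x ((v + l • c1) + (b2 + l • c2)))) = 0 := by
    simp only [map_add, map_smul]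
    linear_combination (norm := (match_scalars <;> grind)) e + o • e2 + ho • x (x v) + ho • x (x (x v))
      + (two0 (k := k)) • (l • x (x (x c1)) + l • x (x (x c2))) + (two0 (k := k)) • (o • x (x (x b1)) + o • x (x (x b2)) + (o • x (x v))) + (two0 (k := k)) • (x (x v) + x (x (x v)))
  have hs := h.split (o := o) (v1 := v + l • c1) (v2 := b2 + l • c2)
    (by simp only [map_add, map_smul, hv, hc1]
        linear_combination (norm := (match_scalars <;> grind)) (0 : k) • hb)
    (by simp only [map_add, map_smul, hb2, hc2]
        linear_combination (norm := (match_scalars <;> grind)) (0 : k) • hb) key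
  simp only [map_add, map_smul] at hs
  refine ⟨l, b1, b2, hb', hb1, ?_, ?_⟩
  · linear_combination (norm := (match_scalars <;> grind)) hs.1
  · linear_combination (norm := (match_scalars <;> grind)) hs.2

end core
end QE

namespace QE
section core2
variable {k V : Type} [Field k] [CharP k 2] [AddCommGroup V] [Module k V] {x y : V →ₗ[k] V}

lemma QX.yxx (h : QX x y) (v : V) : y (x (x v)) = x (x (y v)) := by
  rw [← h.hyy, ← h.hyy]

lemma Core.F2 {w : V} (h : Core x y w) {b : V} (hb : y w = x (x b)) : ∃ c, y w = x (x (x c)) := by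
  have e := h.hyx w
  simp only [h.xw, map_zero, map_add, h.h4, h.N, hb, add_zero, zero_add] at e
  obtain ⟨c, hc⟩ := h.Sx b e.symm
  exact ⟨c, by rw [hb, hc]⟩

/-- Data of the core computation with chosen `c1, c2`. -/
structure Core2 (x y : V →ₗ[k] V) (o : k) (w c1 c2 : V) : Prop extends Core x y w where
  ho : o * o = o + 1
  hyw : y w = x (x (x (c1 + c2)))
  hc1 : x (x (y c1)) = o • x (x (x c1))
  hc2 : x (x (y c2)) = (o + 1) • x (x (x c2))
  wI : ∀ u, w ≠ x (x u)

lemma Core2.swap {o : k} {w c1 c2 : V} (h : Core2 x y o w c1 c2) : Core2 x y (o + 1) w c2 c1 where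
  toCore := h.toCore
  ho := by have := h.ho; grind
  hyw := by rw [h.hyw, add_comm]
  hc1 := h.hc2
  hc2 := by
    have : o + 1 + 1 = o := by grind
    rw [this]; exact h.hc1
  wI := h.wI

lemma Core2.xyw {o : k} {w c1 c2 : V} (h : Core2 x y o w c1 c2) : x (y w) = 0 := by
  rw [h.hyw, h.h4]

lemma Core2.G5 {o : k} {w c1 c2 : V} (h : Core2 x y o w c1 c2) {v : V}
    (hv : x (x (y v)) = o • x (x (x v))) :
    ∃ (l : k) (b1 b2 : V), y v = o • x v + l • w + x (x b1) + x (x b2) ∧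
      x (x (y b1)) = o • x (x (x b1)) ∧ x (x (x v)) = l • x (x (x c1)) ∧
      x (x (x b2)) = l • x (x (x c2)) := h.F5 h.hyw h.ho h.hc1 h.hc2 hv

lemma Core2.span1 {o : k} {w c1 c2 : V} (h : Core2 x y o w c1 c2) (v : V) :
    ∃ (a1 a2 μ : k) (u : V), v = a1 • c1 + a2 • c2 + x u + μ • w := by
  obtain ⟨v1, v2, rfl, h1, h2⟩ := h.F4 h.xyw h.ho v
  obtain ⟨l1, -, -, -, -, e1, -⟩ := h.G5 h1
  obtain ⟨l2, -, -, -, -, e2, -⟩ := h.swap.G5 h2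
  obtain ⟨u, hu⟩ := h.Sx (v1 + v2 - l1 • c1 - l2 • c2) (by simp [e1, e2])
  obtain ⟨u', μ, hu'⟩ := h.K (v1 + v2 - l1 • c1 - l2 • c2 - x u) (by rw [map_sub, map_sub, hu]; simp)
  refine ⟨l1, l2, μ, u + x u', ?_⟩
  rw [map_add]
  linear_combination (norm := module) hu'

lemma Core2.span {o : k} {w c1 c2 : V} (h : Core2 x y o w c1 c2) (v : V) :
    ∃ (a0 a1 a2 a3 b0 b1 b2 b3 μ : k), v = a0 • c1 + a1 • x c1 + a2 • x (x c1) + a3 • x (x (x c1))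
      + b0 • c2 + b1 • x c2 + b2 • x (x c2) + b3 • x (x (x c2)) + μ • w := by
  obtain ⟨a0, b0, μ, u0, e0⟩ := h.span1 v
  obtain ⟨a1, b1, m1, u1, e1⟩ := h.span1 u0
  obtain ⟨a2, b2, m2, u2, e2⟩ := h.span1 u1
  obtain ⟨a3, b3, m3, u3, e3⟩ := h.span1 u2
  refine ⟨a0, a1, a2, a3, b0, b1, b2, b3, μ, ?_⟩
  rw [e0, e1, e2, e3]
  simp only [map_add, map_smul, h.xw, h.h4, smul_zero, add_zero]
  module

lemma Core2.qspan {o : k} {w c1 c2 : V} (h : Core2 x y o w c1 c2) {q : V}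
    (hq : x (x (x q)) = 0) : ∃ s1 s2 : k, x (x q) = s1 • x (x (x c1)) + s2 • x (x (x c2)) := by
  obtain ⟨u, hu⟩ := h.Sx q hq
  obtain ⟨a1, a2, μ, u, rfl⟩ := h.span1 u
  refine ⟨a1, a2, ?_⟩
  rw [hu]
  simp only [map_add, map_smul, h.xw, h.h4, smul_zero, add_zero, map_zero]

lemma Core2.yc1 {o : k} {w c1 c2 : V} (h : Core2 x y o w c1 c2) (hne : x (x (x c1)) ≠ 0) :
    ∃ t s1 s2 : k, y c1 = o • x c1 + w + t • x (x c1) + x (x c2)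
      + s1 • x (x (x c1)) + s2 • x (x (x c2)) := by
  obtain ⟨l, b1, b2, e, hb1, hl, hb2⟩ := h.G5 h.hc1
  have hl1 : l = 1 := by
    have : (l - 1) • x (x (x c1)) = 0 := by rw [sub_smul, one_smul, ← hl, sub_self]
    rcases smul_eq_zero.1 this with h | h
    · linear_combination h
    · exact absurd h hne
  subst hl1
  obtain ⟨l', -, -, -, -, hl', -⟩ := h.G5 hb1
  obtain ⟨s1, s2, hs⟩ := h.qspan (q := b1 - l' • c1) (by simp [hl'])
  obtain ⟨r1, r2, hr⟩ := h.qspan (q := b2 - c2) (by simp [hb2])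
  simp only [map_sub, map_smul] at hs hr
  refine ⟨l', s1 + r1, s2 + r2, ?_⟩
  linear_combination (norm := module) e + hs + hr

/-- The five-dimensional shape. -/
structure Shape5 (x y : V →ₗ[k] V) (o : k) (c w : V) : Prop extends QX x y where
  yc : y c = o • x c + w
  xw : x w = 0
  yw : y w = x (x (x c))
  ne : x (x (x c)) ≠ 0
  wI : ∀ u, w ≠ x (x u)
  span : ∀ v, ∃ a0 a1 a2 a3 μ : k,
    v = a0 • c + a1 • x c + a2 • x (x c) + a3 • x (x (x c)) + μ • w

/-- The nine-dimensional shape. -/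
structure Shape9 (x y : V →ₗ[k] V) (o : k) (c1 c2 w : V) : Prop extends QX x y where
  yc1 : y c1 = o • x c1 + w + x (x c2)
  yc2 : y c2 = (o + 1) • x c2 + w + x (x c1)
  xw : x w = 0
  yw : y w = x (x (x c1)) + x (x (x c2))
  ind : ∀ a b : k, a • x (x (x c1)) + b • x (x (x c2)) = 0 → a = 0 ∧ b = 0
  wI : ∀ u, w ≠ x (x u)
  span : ∀ v, ∃ a0 a1 a2 a3 b0 b1 b2 b3 μ : k,
    v = a0 • c1 + a1 • x c1 + a2 • x (x c1) + a3 • x (x (x c1))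
      + b0 • c2 + b1 • x c2 + b2 • x (x c2) + b3 • x (x (x c2)) + μ • w

lemma Core2.shape5 {o : k} {w c : V} (h : Core2 x y o w c 0) (hne : x (x (x c)) ≠ 0) :
    ∃ c' w', Shape5 x y o c' w' := by
  obtain ⟨t, s, s2, e⟩ := h.yc1 hne
  have hyw := h.hyw
  have ho := h.ho
  simp only [map_zero, smul_zero, add_zero] at e hyw
  refine ⟨c + t • x c, w + (s + t * (t + 1 + o)) • x (x (x c)), h.toQX, ?_, ?_, ?_, ?_, ?_, ?_⟩
  · simp only [map_add, map_smul, h.hyx, e, h.xw, h.h4, h.N, smul_zero, add_zero, map_zero]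
    linear_combination (norm := (match_scalars <;> grind)) (0 : k) • e
  · simp only [map_add, map_smul, h.xw, h.h4, smul_zero, add_zero]
  · simp only [map_add, map_smul, hyw, h.hyx, e, h.xw, h.h4, h.N, smul_zero, add_zero, map_zero]
  · simpa only [map_add, map_smul, h.h4, smul_zero, add_zero] using hne
  · intro u hu
    refine h.wI (u - (s + t * (t + 1 + o)) • x c) ?_
    simp only [map_sub, map_smul, ← hu]
    module
  · intro v
    obtain ⟨a0, a1, a2, a3, b0, b1, b2, b3, μ, e⟩ := h.span v
    simp only [map_zero, smul_zero, add_zero] at e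
    refine ⟨a0, a1 - a0 * t, a2 - (a1 - a0 * t) * t,
      a3 - (a2 - (a1 - a0 * t) * t) * t - μ * (s + t * (t + 1 + o)), μ, ?_⟩
    simp only [map_add, map_smul, h.xw, h.h4, smul_zero, add_zero]
    rw [e]
    module

lemma Core2.shape9 {o : k} {w c1 c2 : V} (h : Core2 x y o w c1 c2) (hne1 : x (x (x c1)) ≠ 0)
    (hne2 : x (x (x c2)) ≠ 0) :
    ∃ c1' c2' w', Shape9 x y o c1' c2' w' := by
  obtain ⟨t, s1, s2, e⟩ := h.yc1 hne1
  obtain ⟨t', s2', s1', e'⟩ := h.swap.yc1 hne2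
  have hyw := h.hyw
  have ho := h.ho
  have hc2 := h.hc2
  have hc1 := h.hc1
  simp only [map_add] at hyw
  have ind : ∀ a b : k, a • x (x (x c1)) + b • x (x (x c2)) = 0 → a = 0 ∧ b = 0 := by
    intro a b hab
    have := h.split (o := o) (v1 := a • c1) (v2 := b • c2) 
      (by simp only [map_smul, hc1]; module) (by simp only [map_smul, hc2]; module)
      (by simpa only [map_add, map_smul] using hab)
    simpa only [map_smul, smul_eq_zero, hne1, hne2, or_false] using this
  obtain ⟨r1, hr1⟩ : ∃ r1, r1 = s1 + t * (t + 1 + o) := ⟨_, rfl⟩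
  obtain ⟨r2, hr2⟩ : ∃ r2, r2 = s2' + t' * (t' + o) := ⟨_, rfl⟩
  obtain ⟨p, hp⟩ : ∃ p, p = s2 + t + r2 + t' := ⟨_, rfl⟩
  obtain ⟨p', hp'⟩ : ∃ p', p' = s1' + t' + r1 + t := ⟨_, rfl⟩
  refine ⟨c1 + t • x c1 + p • x (x c2), c2 + t' • x c2 + p' • x (x c1),
    w + r1 • x (x (x c1)) + r2 • x (x (x c2)), h.toQX, ?_, ?_, ?_, ?_, ?_, ?_, ?_⟩
  · simp only [map_add, map_smul, h.hyx, e, e', h.xw, h.h4, h.N, smul_zero, add_zero, map_zero]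
    linear_combination (norm := (match_scalars <;> grind)) (0 : k) • e
  · simp only [map_add, map_smul, h.hyx, e, e', h.xw, h.h4, h.N, smul_zero, add_zero, map_zero]
    linear_combination (norm := (match_scalars <;> grind)) (0 : k) • e
  · simp only [map_add, map_smul, h.xw, h.h4, smul_zero, add_zero]
  · simp only [map_add, map_smul, hyw, h.hyx, e, e', h.xw, h.h4, h.N, smul_zero, add_zero, map_zero]
  · simpa only [map_add, map_smul, h.h4, smul_zero, add_zero, map_zero] using ind
  · intro u hu
    refine h.wI (u - r1 • x c1 - r2 • x c2) ?_
    simp only [map_sub, map_smul, ← hu]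
    module
  · intro v
    obtain ⟨a0, a1, a2, a3, b0, b1, b2, b3, μ, e⟩ := h.span v
    refine ⟨a0, a1 - a0 * t, a2 - (a1 - a0 * t) * t - b0 * p',
      a3 - (a2 - (a1 - a0 * t) * t - b0 * p') * t - (b1 - b0 * t') * p' - μ * r1, 
      b0, b1 - b0 * t', b2 - (b1 - b0 * t') * t' - a0 * p,
      b3 - (b2 - (b1 - b0 * t') * t' - a0 * p) * t' - (a1 - a0 * t) * p - μ * r2, μ, ?_⟩
    simp only [map_add, map_smul, h.xw, h.h4, smul_zero, add_zero]
    rw [e]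
    module

end core2
end QE

namespace QE
section core3
variable {k V : Type} [Field k] [CharP k 2] [AddCommGroup V] [Module k V] {x y : V →ₗ[k] V}

/-- The classification of modules of even type without projective summands. -/
theorem classify (h : QX x y) (hN : ∀ v, x (x (x (y v))) = 0) {o : k} (ho : o * o = o + 1)
    {w : V} (xw : x w = 0) (wI : ∀ u, w ≠ x (x u))
    (hK : ∀ v, x (x v) = 0 → ∃ u, ∃ μ : k, v = x (x u) + μ • w) :
    (∀ v, ∃ μ : k, v = μ • w) ∨ (∃ c w', Shape5 x y o c w') ∨ (∃ c w', Shape5 x y (o + 1) c w') ∨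
      ∃ c1 c2 w', Shape9 x y o c1 c2 w' := by
  have hC : Core x y w := by
    refine ⟨h, hN, hK, xw, fun v hv => ?_⟩
    obtain ⟨u, μ, e⟩ := hK (x v) hv
    by_cases hμ : μ = 0
    · refine ⟨u, ?_⟩
      rw [e, hμ]; simp
    · exfalso
      have e2 : w = x (μ⁻¹ • (v - x u)) := by
        rw [map_smul, map_sub, e, add_sub_cancel_left, smul_smul, inv_mul_cancel₀ hμ, one_smul]
      obtain ⟨u', μ', e'⟩ := hK (μ⁻¹ • (v - x u)) (by rw [← e2, xw])
      refine wI (x u') ?_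
      rw [e2, e', map_add, map_smul, xw, smul_zero, add_zero]
  have hyI : ∃ b, y w = x (x b) := by
    obtain ⟨b, μ, e⟩ := hK (y w) (by rw [← h.yxx, xw, map_zero, map_zero])
    refine ⟨b, ?_⟩
    by_cases hμ : μ = 0
    · rw [e, hμ]; simp
    · exfalso
      have e2 := congrArg y e
      rw [h.hyy, xw, map_zero, map_add, map_smul, e, h.yxx] at e2
      refine wI (-(μ⁻¹ • b) - μ⁻¹ • (μ⁻¹ • y b)) ?_
      simp only [map_sub, map_neg, map_smul]
      have e3 : μ⁻¹ * μ = 1 := inv_mul_cancel₀ hμ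
      linear_combination (norm := (match_scalars <;> grind)) (-μ⁻¹ * μ⁻¹) • e2
  obtain ⟨b, hb⟩ := hyI
  obtain ⟨c, hc⟩ := hC.F2 hb
  obtain ⟨c1, c2, rfl, h1, h2⟩ := hC.F4 (by rw [hc, h.h4]) ho c
  have H : Core2 x y o w c1 c2 := ⟨hC, ho, hc, h1, h2, wI⟩
  by_cases z1 : x (x (x c1)) = 0
  · have H' : Core2 x y o w 0 c2 := ⟨hC, ho, by rw [hc]; simp [z1], by simp, h2, wI⟩
    by_cases z2 : x (x (x c2)) = 0
    · have H' : Core2 x y o w 0 0 := ⟨hC, ho, by rw [hc]; simp [z1, z2], by simp, by simp, wI⟩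
      left
      intro v
      obtain ⟨a0, a1, a2, a3, b0, b1, b2, b3, μ, e⟩ := H'.span v
      exact ⟨μ, by simpa using e⟩
    · exact Or.inr (Or.inr (Or.inl (H'.swap.shape5 z2)))
  · by_cases z2 : x (x (x c2)) = 0
    · have H' : Core2 x y o w c1 0 := ⟨hC, ho, by rw [hc]; simp [z2], h1, by simp, wI⟩
      exact Or.inr (Or.inl (H'.shape5 z1))
    · exact Or.inr (Or.inr (Or.inr (H.shape9 z1 z2)))

/-- Chouinard-type detection: exactness of `X = x²` and no free summands force zero. -/
theorem chouinard_zero (h : QX x y) (hN : ∀ v, x (x (x (y v))) = 0) {o : k} (ho : o * o = o + 1)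
    (hK : ∀ v, x (x v) = 0 → ∃ u, v = x (x u)) (v : V) : v = 0 := by
  have hC : Core x y 0 := by
    refine ⟨h, hN, fun v hv => ?_, map_zero _, fun v hv => ?_⟩
    · obtain ⟨u, hu⟩ := hK v hv
      exact ⟨u, 0, by simpa using hu⟩
    · obtain ⟨u, e⟩ := hK (x v) hv
      exact ⟨u, by rw [e]⟩
  obtain ⟨a, b, e, h1, h2⟩ := hC.F4 (by simp) ho v
  -- every vector is in the image of x
  have key : ∀ v, ∃ u, v = x u := by
    intro v
    obtain ⟨v1, v2, rfl, h1, h2⟩ := hC.F4 (by simp) ho v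
    obtain ⟨l1, -, -, -, -, e1, -⟩ := hC.F5 (c1 := 0) (c2 := 0) (by simp) ho (by simp) (by simp) h1
    obtain ⟨l2, -, -, -, -, e2, -⟩ := hC.F5 (o := o + 1) (c1 := 0) (c2 := 0) (by simp) (by grind)
      (by simp) (by simp) h2
    simp only [map_zero, smul_zero] at e1 e2
    obtain ⟨u, hu⟩ := hC.Sx (v1 + v2) (by simp [e1, e2])
    obtain ⟨u', hu'⟩ := hK (v1 + v2 - x u) (by rw [map_sub, map_sub, hu, sub_self])
    exact ⟨u + x u', by rw [map_add, ← hu']; abel⟩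
  obtain ⟨u1, rfl⟩ := key v
  obtain ⟨u2, rfl⟩ := key u1
  obtain ⟨u3, rfl⟩ := key u2
  obtain ⟨u4, rfl⟩ := key u3
  exact h.h4 _

lemma Shape5.basis {o : k} {c w : V} (h : Shape5 x y o c w) :
    ∃ B : Module.Basis (Fin 5) k V, ⇑B = ![c, x c, x (x c), x (x (x c)), w] := by
  have li : LinearIndependent k ![c, x c, x (x c), x (x (x c)), w] := by
    rw [Fintype.linearIndependent_iff]
    intro g hg
    simp only [Fin.sum_univ_five] at hg
    change g 0 • c + g 1 • x c + g 2 • x (x c) + g 3 • x (x (x c)) + g 4 • w = 0 at hg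
    have g0 : g 0 = 0 := by
      have := congrArg (fun v => x (x (x v))) hg
      simpa [h.h4, h.xw, h.ne] using this
    have g1 : g 1 = 0 := by
      have := congrArg (fun v => x (x v)) hg
      simpa [h.h4, h.xw, h.ne, g0] using this
    have g2 : g 2 = 0 := by
      have := congrArg (fun v => x v) hg
      simpa [h.h4, h.xw, h.ne, g0, g1] using this
    have g4 : g 4 = 0 := by
      by_contra hne
      refine h.wI (-((g 4)⁻¹ * g 3) • x c) ?_
      simp only [g0, g1, g2, zero_smul, zero_add] at hg
      simp only [map_smul]
      have e3 : (g 4)⁻¹ * g 4 = 1 := inv_mul_cancel₀ hne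
      linear_combination (norm := (match_scalars <;> grind)) (g 4)⁻¹ • hg
    have g3 : g 3 = 0 := by simpa [g0, g1, g2, g4, h.ne] using hg
    intro i
    fin_cases i
    · exact g0
    · exact g1
    · exact g2
    · exact g3
    · exact g4
  refine ⟨Module.Basis.mk li ?_, Module.Basis.coe_mk _ _⟩
  intro v _
  obtain ⟨a0, a1, a2, a3, μ, e⟩ := h.span v
  rw [Submodule.mem_span_range_iff_exists_fun]
  refine ⟨![a0, a1, a2, a3, μ], ?_⟩
  simp only [Fin.sum_univ_five]
  exact e.symm

lemma Shape9.basis {o : k} {c1 c2 w : V} (h : Shape9 x y o c1 c2 w) :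
    ∃ B : Module.Basis (Fin 9) k V, ⇑B = ![c1, x c1, x (x c1), x (x (x c1)),
      c2, x c2, x (x c2), x (x (x c2)), w] := by
  have li : LinearIndependent k ![c1, x c1, x (x c1), x (x (x c1)),
      c2, x c2, x (x c2), x (x (x c2)), w] := by
    rw [Fintype.linearIndependent_iff]
    intro g hg
    simp only [Fin.sum_univ_succ, Fin.sum_univ_zero] at hg
    change g 0 • c1 + (g 1 • x c1 + (g 2 • x (x c1) + (g 3 • x (x (x c1)) +
      (g 4 • c2 + (g 5 • x c2 + (g 6 • x (x c2) + (g 7 • x (x (x c2)) + (g 8 • w + 0)))))))) = 0 at hg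
    have g0 : g 0 = 0 ∧ g 4 = 0 := by
      have := congrArg (fun v => x (x (x v))) hg
      apply h.ind
      simpa [h.h4, h.xw] using this
    have g1 : g 1 = 0 ∧ g 5 = 0 := by
      have := congrArg (fun v => x (x v)) hg
      apply h.ind
      simpa [h.h4, h.xw, g0] using this
    have g2 : g 2 = 0 ∧ g 6 = 0 := by
      have := congrArg (fun v => x v) hg
      apply h.ind
      simpa [h.h4, h.xw, g0, g1] using this
    simp only [g0, g1, g2, zero_smul, zero_add, add_zero] at hg
    have g4 : g 8 = 0 := by
      by_contra hne
      refine h.wI (-((g 8)⁻¹ * g 3) • x c1 -((g 8)⁻¹ * g 7) • x c2) ?_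
      simp only [map_smul, map_sub]
      have e3 : (g 8)⁻¹ * g 8 = 1 := inv_mul_cancel₀ hne
      linear_combination (norm := (match_scalars <;> grind)) (g 8)⁻¹ • hg
    have g3 : g 3 = 0 ∧ g 7 = 0 := by 
      apply h.ind
      simpa [g4] using hg
    intro i
    fin_cases i
    · exact g0.1
    · exact g1.1
    · exact g2.1
    · exact g3.1
    · exact g0.2
    · exact g1.2
    · exact g2.2
    · exact g3.2
    · exact g4
  refine ⟨Module.Basis.mk li ?_, Module.Basis.coe_mk _ _⟩
  intro v _
  obtain ⟨a0, a1, a2, a3, b0, b1, b2, b3, μ, e⟩ := h.span v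
  rw [Submodule.mem_span_range_iff_exists_fun]
  refine ⟨![a0, a1, a2, a3, b0, b1, b2, b3, μ], ?_⟩
  simp only [Fin.sum_univ_succ, Fin.sum_univ_zero]
  change a0 • c1 + (a1 • x c1 + (a2 • x (x c1) + (a3 • x (x (x c1)) +
      (b0 • c2 + (b1 • x c2 + (b2 • x (x c2) + (b3 • x (x (x c2)) + (μ • w + 0)))))))) = v
  rw [e]
  abel

variable {V' : Type} [AddCommGroup V'] [Module k V'] {x' y' : V' →ₗ[k] V'}

theorem Shape5.iso {o : k} {c w : V} (h : Shape5 x y o c w) {c' w' : V'}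
    (h' : Shape5 x' y' o c' w') :
    ∃ f : V ≃ₗ[k] V', (∀ v, f (x v) = x' (f v)) ∧ ∀ v, f (y v) = y' (f v) := by
  obtain ⟨B, hB⟩ := h.basis
  obtain ⟨B', hB'⟩ := h'.basis
  obtain ⟨f, hf⟩ : ∃ f : V ≃ₗ[k] V', ∀ i, f (B i) = B' i := ⟨B.equiv B' (Equiv.refl _), by simp⟩
  rw [hB, hB'] at hf
  have f0 : f c = c' := hf 0
  have f1 : f (x c) = x' c' := hf 1
  have f2 : f (x (x c)) = x' (x' c') := hf 2
  have f3 : f (x (x (x c))) = x' (x' (x' c')) := hf 3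
  have f4 : f w = w' := hf 4
  refine ⟨f, fun v => ?_, fun v => ?_⟩
  · obtain ⟨a0, a1, a2, a3, μ, rfl⟩ := h.span v
    simp only [map_add, map_smul, f0, f1, f2, f3, f4, h.h4, h'.h4, h.xw, h'.xw, map_zero]
  · obtain ⟨a0, a1, a2, a3, μ, rfl⟩ := h.span v
    simp only [map_add, map_smul, f0, f1, f2, f3, f4, h.h4, h'.h4, h.xw, h'.xw, map_zero, h.hyx,
      h'.hyx, h.yc, h'.yc, h.yw, h'.yw]

theorem Shape9.iso {o : k} {c1 c2 w : V} (h : Shape9 x y o c1 c2 w) {c1' c2' w' : V'}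
    (h' : Shape9 x' y' o c1' c2' w') :
    ∃ f : V ≃ₗ[k] V', (∀ v, f (x v) = x' (f v)) ∧ ∀ v, f (y v) = y' (f v) := by
  obtain ⟨B, hB⟩ := h.basis
  obtain ⟨B', hB'⟩ := h'.basis
  obtain ⟨f, hf⟩ : ∃ f : V ≃ₗ[k] V', ∀ i, f (B i) = B' i := ⟨B.equiv B' (Equiv.refl _), by simp⟩
  rw [hB, hB'] at hf
  have f0 : f c1 = c1' := hf 0
  have f1 : f (x c1) = x' c1' := hf 1
  have f2 : f (x (x c1)) = x' (x' c1') := hf 2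
  have f3 : f (x (x (x c1))) = x' (x' (x' c1')) := hf 3
  have f4 : f c2 = c2' := hf 4
  have f5 : f (x c2) = x' c2' := hf 5
  have f6 : f (x (x c2)) = x' (x' c2') := hf 6
  have f7 : f (x (x (x c2))) = x' (x' (x' c2')) := hf 7
  have f8 : f w = w' := hf 8
  refine ⟨f, fun v => ?_, fun v => ?_⟩
  · obtain ⟨a0, a1, a2, a3, b0, b1, b2, b3, μ, rfl⟩ := h.span v
    simp only [map_add, map_smul, f0, f1, f2, f3, f4, f5, f6, f7, f8, h.h4, h'.h4, h.xw, h'.xw, map_zero]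
  · obtain ⟨a0, a1, a2, a3, b0, b1, b2, b3, μ, rfl⟩ := h.span v
    simp only [map_add, map_smul, f0, f1, f2, f3, f4, f5, f6, f7, f8, h.h4, h'.h4, h.xw, h'.xw, map_zero, h.hyx,
      h'.hyx, h.yc1, h'.yc1, h.yc2, h'.yc2, h.yw, h'.yw]

end core3
end QE

namespace QE
section rep
variable {k G : Type} [Field k] [Group G]

/-- underlying linear map -/
abbrev lin {M N : Rep.{0} k G} (f : M ⟶ N) : M.V →ₗ[k] N.V := f.hom.toLinearMap

lemma lin_ext {M N : Rep.{0} k G} {f g : M ⟶ N} (h : ∀ v, lin f v = lin g v) : f = g := by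
  apply Rep.hom_ext
  apply Representation.IntertwiningMap.ext
  exact LinearMap.ext h

/-- morphisms from equivariant linear maps -/
def mkHom {M N : Rep.{0} k G} (f : M.V →ₗ[k] N.V) (h : ∀ g v, f (M.ρ g v) = N.ρ g (f v)) : M ⟶ N :=
  Rep.ofHom (ρ := M.ρ) (σ := N.ρ) ⟨f, fun g => LinearMap.ext fun v => h g v⟩

@[simp] lemma lin_mkHom {M N : Rep.{0} k G} (f : M.V →ₗ[k] N.V) (h) : lin (mkHom f h) = f := rfl
@[simp] lemma lin_comp {M N O : Rep.{0} k G} (f : M ⟶ N) (g : N ⟶ O) (v : M.V) :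
    lin (f ≫ g) v = lin g (lin f v) := rfl
@[simp] lemma lin_id {M : Rep.{0} k G} (v : M.V) : lin (𝟙 M) v = v := rfl
@[simp] lemma lin_zero {M N : Rep.{0} k G} (v : M.V) : lin (0 : M ⟶ N) v = 0 := rfl
@[simp] lemma lin_add {M N : Rep.{0} k G} (f g : M ⟶ N) (v : M.V) :
    lin (f + g) v = lin f v + lin g v := rfl
@[simp] lemma lin_neg {M N : Rep.{0} k G} (f : M ⟶ N) (v : M.V) :
    lin (-f) v = - lin f v := rfl
@[simp] lemma lin_sub {M N : Rep.{0} k G} (f g : M ⟶ N) (v : M.V) :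
    lin (f - g) v = lin f v - lin g v := by
  rw [sub_eq_add_neg, lin_add, lin_neg, sub_eq_add_neg]
lemma lin_eqv {M N : Rep.{0} k G} (f : M ⟶ N) (g : G) (v : M.V) :
    lin f (M.ρ g v) = N.ρ g (lin f v) := Rep.hom_comm_apply f g v

variable [Fintype G]

/-- relative trace of a linear map -/
noncomputable def tr {M N : Rep.{0} k G} (φ : M.V →ₗ[k] N.V) : M ⟶ N :=
  mkHom (∑ g : G, N.ρ g ∘ₗ φ ∘ₗ M.ρ g⁻¹) (by
    intro h v
    simp only [LinearMap.sum_apply, LinearMap.comp_apply, map_sum]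
    refine Fintype.sum_equiv (Equiv.mulLeft h⁻¹) _ _ fun g => ?_
    simp only [Equiv.coe_mulLeft, ← Module.End.mul_apply, ← map_mul]
    congr 2 <;> simp)

lemma tr_apply {M N : Rep.{0} k G} (φ : M.V →ₗ[k] N.V) (v : M.V) :
    lin (tr φ) v = ∑ g : G, N.ρ g (φ (M.ρ g⁻¹ v)) := by
  simp [tr, LinearMap.sum_apply]

lemma tr_comp {M N O : Rep.{0} k G} (φ : M.V →ₗ[k] N.V) (f : N ⟶ O) : tr φ ≫ f = tr (lin f ∘ₗ φ) := by
  apply lin_ext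
  intro v
  simp only [lin_comp, tr_apply, map_sum, lin_eqv, LinearMap.comp_apply]

lemma comp_tr {M N O : Rep.{0} k G} (f : M ⟶ N) (φ : N.V →ₗ[k] O.V) : f ≫ tr φ = tr (φ ∘ₗ lin f) := by
  apply lin_ext
  intro v
  simp only [lin_comp, tr_apply, map_sum, lin_eqv, LinearMap.comp_apply]

/-- morphisms factoring through a projective -/
def FP {M N : Rep.{0} k G} (f : M ⟶ N) : Prop := ∃ φ : M.V →ₗ[k] N.V, f = tr φ

lemma FP.comp_right {M N O : Rep.{0} k G} {f : M ⟶ N} (h : FP f) (g : N ⟶ O) : FP (f ≫ g) := by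
  obtain ⟨φ, rfl⟩ := h
  exact ⟨_, tr_comp _ _⟩

lemma FP.comp_left {M N O : Rep.{0} k G} {g : N ⟶ O} (h : FP g) (f : M ⟶ N) : FP (f ≫ g) := by
  obtain ⟨φ, rfl⟩ := h
  exact ⟨_, comp_tr _ _⟩

lemma FP.add {M N : Rep.{0} k G} {f g : M ⟶ N} (hf : FP f) (hg : FP g) : FP (f + g) := by
  obtain ⟨φ, rfl⟩ := hf
  obtain ⟨ψ, rfl⟩ := hg
  refine ⟨φ + ψ, lin_ext fun v => ?_⟩
  simp [tr_apply, Finset.sum_add_distrib]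

lemma FP.neg {M N : Rep.{0} k G} {f : M ⟶ N} (hf : FP f) : FP (-f) := by
  obtain ⟨φ, rfl⟩ := hf
  refine ⟨-φ, lin_ext fun v => ?_⟩
  simp [tr_apply, Finset.sum_neg_distrib]

lemma FP.sub {M N : Rep.{0} k G} {f g : M ⟶ N} (hf : FP f) (hg : FP g) : FP (f - g) := by
  rw [sub_eq_add_neg]; exact hf.add hg.neg

lemma FP.zero {M N : Rep.{0} k G} : FP (0 : M ⟶ N) :=
  ⟨0, lin_ext fun v => by simp [tr_apply]⟩

lemma FP.of_left {M N : Rep.{0} k G} (h : FP (𝟙 M)) (f : M ⟶ N) : FP f := by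
  simpa using h.comp_right f
lemma FP.of_right {M N : Rep.{0} k G} (h : FP (𝟙 N)) (f : M ⟶ N) : FP f := by
  simpa using h.comp_left f

/-- The (co)induced module. -/
def IndRho (M : Rep.{0} k G) : Representation k G (G → M.V) where
  toFun g := LinearMap.pi fun h => M.ρ g ∘ₗ LinearMap.proj (g⁻¹ * h)
  map_one' := by
    ext f h
    simp
  map_mul' a b := by
    refine LinearMap.ext fun f => funext fun h => ?_
    simp [mul_assoc]

/-- The (co)induced module. -/
abbrev Ind (M : Rep.{0} k G) : Rep.{0} k G := Rep.of (IndRho M)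

@[simp] lemma Ind_apply (M : Rep.{0} k G) (g : G) (f : G → M.V) (h : G) :
    (IndRho M g f) h = M.ρ g (f (g⁻¹ * h)) := rfl

open Classical in
lemma Ind_FP (M : Rep.{0} k G) : FP (𝟙 (Ind M)) := by
  refine ⟨LinearMap.single k (fun _ : G => M.V) 1 ∘ₗ LinearMap.proj (1 : G), lin_ext fun f => ?_⟩
  rw [tr_apply]
  funext h
  refine Eq.trans ?_ (Finset.sum_apply (M := fun _ : G => M.V) h Finset.univ _).symm
  rw [Finset.sum_eq_single h]
  · change f h = M.ρ h (Pi.single (M := fun _ : G => M.V) 1 (M.ρ h⁻¹ (f (h⁻¹⁻¹ * 1))) (h⁻¹ * h))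
    simp
  · intro b _ hb
    change M.ρ b (Pi.single (M := fun _ : G => M.V) 1 (M.ρ b⁻¹ (f (b⁻¹⁻¹ * 1))) (b⁻¹ * h)) = 0
    rw [Pi.single_eq_of_ne, map_zero]
    intro h0
    exact hb (inv_mul_eq_one.1 h0)
  · simp

/-- constant functions -/
def toInd (M : Rep.{0} k G) : M ⟶ Ind M :=
  mkHom (N := Ind M) (LinearMap.pi fun _ => LinearMap.id) (by intro g v; funext h; simp)

@[simp] lemma toInd_apply (M : Rep.{0} k G) (v : M.V) (h : G) : (lin (toInd M) v : G → M.V) h = v := rfl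

lemma toInd_inj (M : Rep.{0} k G) : Function.Injective (lin (toInd M)) := fun _ _ h => congrFun h 1

/-- the map out of the induced module attached to a linear map -/
def fromInd {M N : Rep.{0} k G} (φ : M.V →ₗ[k] N.V) : Ind M ⟶ N :=
  mkHom (M := Ind M) (∑ h : G, (N.ρ h ∘ₗ φ ∘ₗ M.ρ h⁻¹) ∘ₗ LinearMap.proj h) (by
    intro g v
    simp only [LinearMap.sum_apply, LinearMap.comp_apply, map_sum, LinearMap.proj_apply]
    refine Fintype.sum_equiv (Equiv.mulLeft g⁻¹) _ _ fun h => ?_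
    simp only [Equiv.coe_mulLeft, ← Module.End.mul_apply, ← map_mul, Rep.of_ρ, Ind_apply]
    congr 2 <;> simp)

lemma fromInd_apply {M N : Rep.{0} k G} (φ : M.V →ₗ[k] N.V) (f : G → M.V) :
    lin (fromInd φ) f = ∑ h : G, N.ρ h (φ (M.ρ h⁻¹ (f h))) := by
  simp [fromInd]

lemma tr_eq {M N : Rep.{0} k G} (φ : M.V →ₗ[k] N.V) : tr φ = toInd M ≫ fromInd φ := by
  apply lin_ext; intro v
  rw [lin_comp, tr_apply, fromInd_apply]
  rfl

/-- the sum map, a split surjection -/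
def sumInd (M : Rep.{0} k G) : Ind M ⟶ M :=
  mkHom (M := Ind M) (∑ h : G, LinearMap.proj h) (by
    intro g v
    simp only [LinearMap.sum_apply, LinearMap.comp_apply, map_sum, LinearMap.proj_apply]
    refine Fintype.sum_equiv (Equiv.mulLeft g⁻¹) _ _ fun h => ?_
    simp)

lemma sumInd_apply (M : Rep.{0} k G) (f : G → M.V) : lin (sumInd M) f = ∑ h : G, f h := by
  simp [sumInd]

open Classical in
lemma sumInd_surj (M : Rep.{0} k G) : Function.Surjective (lin (sumInd M)) := by
  intro v
  refine ⟨(Pi.single 1 v : G → M.V), ?_⟩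
  rw [sumInd_apply]
  simp

lemma surj_of_epi {M N : Rep.{0} k G} (f : M ⟶ N) [Epi f] : Function.Surjective (lin f) :=
  (Rep.epi_iff_surjective f).1 inferInstance
lemma inj_of_mono {M N : Rep.{0} k G} (f : M ⟶ N) [Mono f] : Function.Injective (lin f) :=
  (Rep.mono_iff_injective f).1 inferInstance

lemma FP.lift {M N E : Rep.{0} k G} {f : M ⟶ N} (hf : FP f) (p : E ⟶ N) [Epi p] :
    ∃ f' : M ⟶ E, f' ≫ p = f := by
  obtain ⟨φ, rfl⟩ := hf
  obtain ⟨s, hs⟩ := (lin p).exists_rightInverse_of_surjective (LinearMap.range_eq_top.2 (surj_of_epi p))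
  refine ⟨tr (s ∘ₗ φ), ?_⟩
  rw [tr_comp, ← LinearMap.comp_assoc, hs, LinearMap.id_comp]

lemma FP.extend {M N E : Rep.{0} k G} {f : M ⟶ N} (hf : FP f) (i : M ⟶ E) [Mono i] :
    ∃ f' : E ⟶ N, i ≫ f' = f := by
  obtain ⟨φ, rfl⟩ := hf
  obtain ⟨s, hs⟩ := (lin i).exists_leftInverse_of_injective (LinearMap.ker_eq_bot.2 (inj_of_mono i))
  refine ⟨tr (φ ∘ₗ s), ?_⟩
  rw [comp_tr, LinearMap.comp_assoc, hs, LinearMap.comp_id]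

lemma projective_iff (P : Rep.{0} k G) : Projective P ↔ FP (𝟙 P) := by
  constructor
  · intro h
    have : Epi (sumInd P) := (Rep.epi_iff_surjective _).2 (sumInd_surj P)
    have e := Projective.factorThru_comp (𝟙 P) (sumInd P)
    rw [← e]
    exact ((Ind_FP P).of_left _).comp_left _
  · intro h
    refine ⟨fun {E X} f e _ => ?_⟩
    exact (h.of_left f).lift e

/-- stable equivalence -/
def SEq (M N : Rep.{0} k G) : Prop :=
  ∃ (f : M ⟶ N) (g : N ⟶ M), FP (f ≫ g - 𝟙 M) ∧ FP (g ≫ f - 𝟙 N)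

lemma SEq.of_iso {M N : Rep.{0} k G} (i : M ≅ N) : SEq M N :=
  ⟨i.hom, i.inv, by simpa using FP.zero, by simpa using FP.zero⟩

lemma SEq.refl (M : Rep.{0} k G) : SEq M M := SEq.of_iso (Iso.refl M)
lemma SEq.symm {M N : Rep.{0} k G} (h : SEq M N) : SEq N M := by
  obtain ⟨f, g, h1, h2⟩ := h
  exact ⟨g, f, h2, h1⟩

lemma FP.aux {M N : Rep.{0} k G} {f : M ⟶ N} {g : N ⟶ M} (h : FP (f ≫ g - 𝟙 M)) {O : Rep.{0} k G}
    {f' : N ⟶ O} {g' : O ⟶ N} (h' : FP (f' ≫ g' - 𝟙 N)) : FP ((f ≫ f') ≫ (g' ≫ g) - 𝟙 M) := by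
  have : (f ≫ f') ≫ (g' ≫ g) - 𝟙 M = f ≫ (f' ≫ g' - 𝟙 N) ≫ g + (f ≫ g - 𝟙 M) := by
    simp only [Preadditive.comp_sub, Preadditive.sub_comp, Category.assoc, Category.id_comp]
    abel
  rw [this]
  exact ((h'.comp_right g).comp_left f).add h

lemma SEq.trans {M N O : Rep.{0} k G} (h : SEq M N) (h' : SEq N O) : SEq M O := by
  obtain ⟨f, g, h1, h2⟩ := h
  obtain ⟨f', g', h1', h2'⟩ := h'
  exact ⟨f ≫ f', g' ≫ g, h1.aux h1', h2'.aux h2⟩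

lemma FP.of_factor {M N Q : Rep.{0} k G} (h : FP (𝟙 Q)) (f : M ⟶ Q) (g : Q ⟶ N) : FP (f ≫ g) :=
  (h.of_left g).comp_left f

lemma SEq.of_stablyIso {M N : Rep.{0} k G} (h : IsStablyIso M N) : SEq M N := by
  obtain ⟨P, Q, hP, hQ, ⟨i⟩⟩ := h
  rw [projective_iff] at hP hQ
  refine ⟨biprod.inl ≫ i.hom ≫ biprod.fst, biprod.inl ≫ i.inv ≫ biprod.fst, ?_, ?_⟩
  · have e : (biprod.inl ≫ i.hom ≫ biprod.fst) ≫ biprod.inl ≫ i.inv ≫ biprod.fst - 𝟙 M =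
      - ((biprod.inl ≫ i.hom ≫ biprod.snd) ≫ (biprod.inr ≫ i.inv ≫ biprod.fst)) := by
      have t := congrArg (fun z => (biprod.inl ≫ i.hom) ≫ z ≫ (i.inv ≫ biprod.fst)) (biprod.total (X := N) (Y := Q))
      simp only [Preadditive.comp_add, Preadditive.add_comp, Category.assoc, Category.id_comp, Iso.hom_inv_id_assoc, biprod.inl_fst] at t
      simp only [Category.assoc]
      rw [← t]; abel
    rw [e]
    exact (FP.of_factor hQ _ _).neg
  · have e : (biprod.inl ≫ i.inv ≫ biprod.fst) ≫ biprod.inl ≫ i.hom ≫ biprod.fst - 𝟙 N =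
      - ((biprod.inl ≫ i.inv ≫ biprod.snd) ≫ (biprod.inr ≫ i.hom ≫ biprod.fst)) := by
      have t := congrArg (fun z => (biprod.inl ≫ i.inv) ≫ z ≫ (i.hom ≫ biprod.fst)) (biprod.total (X := M) (Y := P))
      simp only [Preadditive.comp_add, Preadditive.add_comp, Category.assoc, Category.id_comp, Iso.inv_hom_id_assoc, biprod.inl_fst] at t
      simp only [Category.assoc]
      rw [← t]; abel
    rw [e]
    exact (FP.of_factor hP _ _).neg

end rep
end QE

namespace QE
section rep
variable {k G : Type} [Field k] [Group G] [Fintype G]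

lemma SEq.stablyIso {M N : Rep.{0} k G} (h : SEq M N) : IsStablyIso M N := by
  obtain ⟨f, g, ⟨φ, hφ⟩, h2⟩ := h
  let a : M ⟶ N ⊞ Ind M := biprod.lift f (toInd M)
  let r : N ⊞ Ind M ⟶ M := biprod.desc g (-fromInd φ)
  have har : a ≫ r = 𝟙 M := by
    simp only [a, r, biprod.lift_desc, Preadditive.comp_neg, ← tr_eq, ← hφ]
    abel
  let σ : cokernel a ⟶ N ⊞ Ind M := cokernel.desc a (𝟙 _ - r ≫ a) (by
    rw [Preadditive.comp_sub, ← Category.assoc, har]; simp)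
  have hπσ : cokernel.π a ≫ σ = 𝟙 _ - r ≫ a := cokernel.π_desc _ _ _
  have hσπ : σ ≫ cokernel.π a = 𝟙 _ := by
    rw [← cancel_epi (cokernel.π a), ← Category.assoc, hπσ, Preadditive.sub_comp, Category.assoc,
      cokernel.condition]
    simp
  have hσr : σ ≫ r = 0 := by
    rw [← cancel_epi (cokernel.π a), ← Category.assoc, hπσ, Preadditive.sub_comp, Category.assoc, har]
    simp
  let b : BinaryBicone M (cokernel a) := ⟨N ⊞ Ind M, r, cokernel.π a, a, σ, har, cokernel.condition a,
    hσr, hσπ⟩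
  have hb : b.IsBilimit := isBinaryBilimitOfTotal b (by simp only [b]; rw [hπσ]; abel)
  have hfp : FP (𝟙 _ - r ≫ a) := by
    have hI := Ind_FP M
    have h11 : FP (biprod.inl ≫ (𝟙 _ - r ≫ a) ≫ biprod.fst) := by
      have : biprod.inl ≫ (𝟙 _ - r ≫ a) ≫ biprod.fst = -(g ≫ f - 𝟙 N) := by
        simp [a, r, Preadditive.comp_sub, Preadditive.sub_comp]
      rw [this]
      exact h2.neg
    have e : (𝟙 _ - r ≫ a) = biprod.fst ≫ (biprod.inl ≫ (𝟙 _ - r ≫ a) ≫ biprod.fst) ≫ biprod.inl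
        + (biprod.fst ≫ biprod.inl ≫ (𝟙 _ - r ≫ a) ≫ biprod.snd) ≫ biprod.inr
        + biprod.snd ≫ (biprod.inr ≫ (𝟙 _ - r ≫ a)) := by
      have t : (𝟙 _ - r ≫ a) = (biprod.fst ≫ biprod.inl + biprod.snd ≫ biprod.inr) ≫ (𝟙 _ - r ≫ a) := by
        rw [biprod.total, Category.id_comp]
      have t2 : ((biprod.fst : N ⊞ Ind M ⟶ N) ≫ biprod.inl) ≫ (𝟙 _ - r ≫ a) = (biprod.fst ≫ biprod.inl) ≫
          (𝟙 _ - r ≫ a) ≫ (biprod.fst ≫ biprod.inl + biprod.snd ≫ biprod.inr) := by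
        rw [biprod.total, Category.comp_id]
      conv_lhs => rw [t, Preadditive.add_comp, t2]
      simp only [Preadditive.comp_add, Category.assoc]
    rw [e]
    exact (((h11.comp_right _).comp_left _).add (FP.of_factor hI _ _)).add (FP.of_factor hI _ _)
  refine ⟨cokernel a, Ind M, ?_, (projective_iff _).2 (Ind_FP M), ⟨(biprod.uniqueUpToIso _ _ hb).symm⟩⟩
  rw [projective_iff]
  have : 𝟙 (cokernel a) = σ ≫ (𝟙 _ - r ≫ a) ≫ cokernel.π a := by
    rw [← hπσ, Category.assoc, hσπ, Category.comp_id, hσπ]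
  rw [this]
  exact (hfp.comp_right _).comp_left _

lemma stablyIso_iff {M N : Rep.{0} k G} : IsStablyIso M N ↔ SEq M N :=
  ⟨SEq.of_stablyIso, SEq.stablyIso⟩

lemma FP.whisker {M N : Rep.{0} k G} {f : M ⟶ N} (h : FP f) (L : Rep.{0} k G) : FP (f ▷ L) := by
  obtain ⟨φ, rfl⟩ := h
  refine ⟨TensorProduct.map φ LinearMap.id, lin_ext fun v => ?_⟩
  rw [tr_apply]
  change (TensorProduct.map (lin (tr φ)) LinearMap.id : TensorProduct k M.V L.V →ₗ[k] TensorProduct k N.V L.V) v = _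
  refine LinearMap.congr_fun (f := (TensorProduct.map (lin (tr φ)) LinearMap.id : TensorProduct k M.V L.V →ₗ[k] TensorProduct k N.V L.V))
    (g := ∑ g : G, TensorProduct.map (N.ρ g) (L.ρ g) ∘ₗ TensorProduct.map φ LinearMap.id ∘ₗ TensorProduct.map (M.ρ g⁻¹) (L.ρ g⁻¹)) ?_ v |>.trans ?_
  · refine TensorProduct.ext' fun m l => ?_
    rw [LinearMap.sum_apply, TensorProduct.map_tmul, tr_apply, TensorProduct.sum_tmul]
    simp [TensorProduct.map_tmul]
  · rw [LinearMap.sum_apply]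
    rfl

lemma SEq.whisker {M N : Rep.{0} k G} (h : SEq M N) (L : Rep.{0} k G) : SEq (M ⊗ L) (N ⊗ L) := by
  obtain ⟨f, g, h1, h2⟩ := h
  refine ⟨f ▷ L, g ▷ L, ?_, ?_⟩
  · have := h1.whisker L
    have e : (f ≫ g - 𝟙 M) ▷ L = f ▷ L ≫ g ▷ L - 𝟙 (M ⊗ L) := by
      rw [eq_sub_iff_add_eq, ← id_whiskerRight, ← MonoidalPreadditive.add_whiskerRight,
        sub_add_cancel, comp_whiskerRight]
    rwa [e] at this
  · have := h2.whisker L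
    have e : (g ≫ f - 𝟙 N) ▷ L = g ▷ L ≫ f ▷ L - 𝟙 (N ⊗ L) := by
      rw [eq_sub_iff_add_eq, ← id_whiskerRight, ← MonoidalPreadditive.add_whiskerRight,
        sub_add_cancel, comp_whiskerRight]
    rwa [e] at this

/-- Short exact sequences with projective middle term. -/
def Syz (M' M : Rep.{0} k G) : Prop :=
  ∃ (P : Rep.{0} k G) (f : M' ⟶ P) (g : P ⟶ M) (w : f ≫ g = 0),
    FP (𝟙 P) ∧ (ShortComplex.mk f g w).ShortExact

lemma syz_aux {A M P : Rep.{0} k G} {i : A ⟶ P} {p : P ⟶ M} {w : i ≫ p = 0} (hP : FP (𝟙 P))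
    (hS : (ShortComplex.mk i p w).ShortExact) {e : M ⟶ M} {E : P ⟶ P} {e' : A ⟶ A}
    (h1 : E ≫ p = p ≫ e) (h2 : i ≫ E = e' ≫ i) :
    FP (e - 𝟙 M) ↔ FP (e' - 𝟙 A) := by
  have : Mono i := hS.mono_f
  have : Epi p := hS.epi_g
  constructor
  · intro h
    obtain ⟨t, ht⟩ := h.lift p
    obtain ⟨D, hD⟩ : ∃ D : P ⟶ A, D ≫ i = E - 𝟙 P - p ≫ t := by
      refine ⟨hS.exact.lift (E - 𝟙 P - p ≫ t) ?_, hS.exact.lift_f _ _⟩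
      simp only [Preadditive.sub_comp, h1, Category.assoc, ht, Preadditive.comp_sub]
      simp
    have : e' - 𝟙 A = i ≫ D := by
      rw [← cancel_mono i, Category.assoc, hD]
      simp only [Preadditive.comp_sub, Preadditive.sub_comp, h2, ← Category.assoc, w]
      simp
    rw [this]
    exact (hP.of_left D).comp_left i
  · intro h
    obtain ⟨t, ht⟩ := h.extend i
    obtain ⟨D, hD⟩ : ∃ D : M ⟶ P, p ≫ D = E - 𝟙 P - t ≫ i := by
      refine ⟨hS.exact.desc (E - 𝟙 P - t ≫ i) ?_, hS.exact.g_desc _ _⟩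
      simp only [Preadditive.comp_sub, h2, ← Category.assoc, ht, Preadditive.sub_comp]
      simp
    have : e - 𝟙 M = D ≫ p := by
      rw [← cancel_epi p, ← Category.assoc, hD]
      simp only [Preadditive.comp_sub, Preadditive.sub_comp, h1, Category.assoc, w]
      simp
    rw [this]
    exact (hP.of_right D).comp_right p

lemma Syz.seq_down {A M B N : Rep.{0} k G} (h : Syz A M) (h' : Syz B N) (hs : SEq M N) : SEq A B := by
  obtain ⟨P, i, p, w, hP, hS⟩ := h
  obtain ⟨Q, j, q, w', hQ, hS'⟩ := h'
  have : Mono i := hS.mono_f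
  have : Epi p := hS.epi_g
  have : Mono j := hS'.mono_f
  have : Epi q := hS'.epi_g
  obtain ⟨f, g, h1, h2⟩ := hs
  obtain ⟨F, hF⟩ := (hP.of_left (p ≫ f)).lift q
  obtain ⟨K, hK⟩ := (hQ.of_left (q ≫ g)).lift p
  obtain ⟨f', hf'⟩ : ∃ f' : A ⟶ B, f' ≫ j = i ≫ F :=
    ⟨hS'.exact.lift (i ≫ F) (by simp [hF, reassoc_of% w]), hS'.exact.lift_f _ _⟩
  obtain ⟨g', hg'⟩ : ∃ g' : B ⟶ A, g' ≫ i = j ≫ K :=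
    ⟨hS.exact.lift (j ≫ K) (by simp [hK, reassoc_of% w']), hS.exact.lift_f _ _⟩
  refine ⟨f', g', ?_, ?_⟩
  · refine (syz_aux hP hS (E := F ≫ K) (e := f ≫ g) ?_ ?_).1 h1
    · rw [Category.assoc, hK, reassoc_of% hF]
    · rw [Category.assoc, hg', reassoc_of% hf']
  · refine (syz_aux hQ hS' (E := K ≫ F) (e := g ≫ f) ?_ ?_).1 h2
    · rw [Category.assoc, hF, reassoc_of% hK]
    · rw [Category.assoc, hf', reassoc_of% hg']

lemma Syz.seq_up {A M B N : Rep.{0} k G} (h : Syz A M) (h' : Syz B N) (hs : SEq A B) : SEq M N := by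
  obtain ⟨P, i, p, w, hP, hS⟩ := h
  obtain ⟨Q, j, q, w', hQ, hS'⟩ := h'
  have : Mono i := hS.mono_f
  have : Epi p := hS.epi_g
  have : Mono j := hS'.mono_f
  have : Epi q := hS'.epi_g
  obtain ⟨f, g, h1, h2⟩ := hs
  obtain ⟨F, hF⟩ := (hQ.of_right (f ≫ j)).extend i
  obtain ⟨K, hK⟩ := (hP.of_right (g ≫ i)).extend j
  obtain ⟨f', hf'⟩ : ∃ f' : M ⟶ N, p ≫ f' = F ≫ q :=
    ⟨hS.exact.desc (F ≫ q) (by simp [reassoc_of% hF, w']), hS.exact.g_desc _ _⟩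
  obtain ⟨g', hg'⟩ : ∃ g' : N ⟶ M, q ≫ g' = K ≫ p :=
    ⟨hS'.exact.desc (K ≫ p) (by simp [reassoc_of% hK, w]), hS'.exact.g_desc _ _⟩
  refine ⟨f', g', ?_, ?_⟩
  · refine (syz_aux hP hS (E := F ≫ K) (e' := f ≫ g) ?_ ?_).2 h1
    · rw [Category.assoc, reassoc_of% hf', hg']
    · rw [Category.assoc, ← hK, reassoc_of% hF]
  · refine (syz_aux hQ hS' (E := K ≫ F) (e' := g ≫ f) ?_ ?_).2 h2
    · rw [Category.assoc, reassoc_of% hg', hf']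
    · rw [Category.assoc, ← hF, reassoc_of% hK]

lemma shortExact_iff {S : ShortComplex (Rep.{0} k G)} : S.ShortExact ↔
    Function.Injective (lin S.f) ∧ Function.Exact (lin S.f) (lin S.g) ∧ Function.Surjective (lin S.g) := by
  have h1 : S.Exact ↔ Function.Exact (lin S.f) (lin S.g) := by
    rw [← S.exact_map_iff_of_faithful (forget₂ (Rep.{0} k G) (ModuleCat k)),
      ShortComplex.ShortExact.moduleCat_exact_iff_function_exact]
    rfl
  rw [← h1]
  constructor
  · intro h
    have := h.mono_f
    have := h.epi_g
    exact ⟨inj_of_mono _, h.exact, surj_of_epi _⟩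
  · rintro ⟨a, b, c⟩
    have := (Rep.mono_iff_injective S.f).2 a
    have := (Rep.epi_iff_surjective S.g).2 c
    exact ⟨b⟩

lemma Syz.mk' {A P M : Rep.{0} k G} (hP : FP (𝟙 P)) (f : A ⟶ P) (g : P ⟶ M)
    (hf : Function.Injective (lin f)) (hfg : Function.Exact (lin f) (lin g))
    (hg : Function.Surjective (lin g)) : Syz A M := by
  have w : f ≫ g = 0 := lin_ext fun v => (hfg _).2 ⟨v, rfl⟩
  exact ⟨P, f, g, w, hP, shortExact_iff.2 ⟨hf, hfg, hg⟩⟩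

lemma Syz.elim {A M : Rep.{0} k G} (h : Syz A M) : ∃ (P : Rep.{0} k G) (f : A ⟶ P) (g : P ⟶ M),
    FP (𝟙 P) ∧ Function.Injective (lin f) ∧ Function.Exact (lin f) (lin g) ∧
    Function.Surjective (lin g) := by
  obtain ⟨P, f, g, w, hP, hS⟩ := h
  obtain ⟨a, b, c⟩ := shortExact_iff.1 hS
  exact ⟨P, f, g, hP, a, b, c⟩

lemma Syz.whisker {A M : Rep.{0} k G} (h : Syz A M) (L : Rep.{0} k G) : Syz (A ⊗ L) (M ⊗ L) := by
  obtain ⟨P, f, g, hP, a, b, c⟩ := h.elim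
  refine Syz.mk' (P := P ⊗ L) ?_ (f ▷ L) (g ▷ L) ?_ ?_ ?_
  · have := hP.whisker L
    rwa [id_whiskerRight] at this
  · exact Module.Flat.rTensor_preserves_injective_linearMap (M := L.V) (lin f) a
  · exact rTensor_exact L.V b c
  · exact LinearMap.rTensor_surjective L.V c

end rep
end QE

namespace QE
section q8
variable {k G : Type} [Field k] [CharP k 2] [Group G] [Fintype G] (e : G ≃* QuaternionGroup 2)

/-- first generator -/
def th : G := e.symm (QuaternionGroup.a 1)
/-- second generator -/
def ta : G := e.symm (QuaternionGroup.xa 0)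

lemma th4 : th e * th e * (th e * th e) = 1 := by
  simp only [th, ← map_mul, map_eq_one_iff e.symm e.symm.injective]; decide
lemma ta2 : ta e * ta e = th e * th e := by
  simp only [th, ta, ← map_mul, e.symm.injective.eq_iff]; decide
lemma tath : ta e * th e = th e * th e * (th e * ta e) := by
  simp only [th, ta, ← map_mul, e.symm.injective.eq_iff]; decide
lemma gen (g : G) : ∃ i j : ℕ, g = th e ^ i * ta e ^ j := by
  have : ∀ q : QuaternionGroup 2, ∃ i : Fin 4, ∃ j : Fin 2,
      q = QuaternionGroup.a 1 ^ (i : ℕ) * QuaternionGroup.xa 0 ^ (j : ℕ) := by decide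
  obtain ⟨i, j, h⟩ := this (e g)
  refine ⟨i, j, ?_⟩
  apply e.injective
  simp [h, th, ta]

lemma sum_G {A : Type} [AddCommMonoid A] (F : G → A) : ∑ g : G, F g =
    F 1 + F (th e * th e) + (F (th e) + F (th e * th e * th e)) + (F (ta e) + F (th e * th e * ta e))
      + (F (th e * ta e) + F (th e * th e * (th e * ta e))) := by
  have h1 : (Finset.univ : Finset (QuaternionGroup 2)) = {1, .a 1 * .a 1, .a 1, .a 1 * .a 1 * .a 1,
    .xa 0, .a 1 * .a 1 * .xa 0, .a 1 * .xa 0, .a 1 * .a 1 * (.a 1 * .xa 0)} := by decide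
  rw [← Equiv.sum_comp e.symm.toEquiv, h1]
  rw [Finset.sum_insert (by decide), Finset.sum_insert (by decide), Finset.sum_insert (by decide),
    Finset.sum_insert (by decide), Finset.sum_insert (by decide), Finset.sum_insert (by decide),
    Finset.sum_insert (by decide), Finset.sum_singleton]
  simp only [th, ta, MulEquiv.toEquiv_eq_coe, MulEquiv.coe_toEquiv, EquivLike.coe_coe, map_mul, map_one]
  abel

/-- the operator `θ - 1` -/
def X (M : Rep.{0} k G) : M.V →ₗ[k] M.V := M.ρ (th e) - 1
/-- the operator `τ - 1` -/
def Y (M : Rep.{0} k G) : M.V →ₗ[k] M.V := M.ρ (ta e) - 1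

lemma X_apply (M : Rep.{0} k G) (v : M.V) : X e M v = M.ρ (th e) v - v := rfl
lemma Y_apply (M : Rep.{0} k G) (v : M.V) : Y e M v = M.ρ (ta e) v - v := rfl

lemma rho4 (M : Rep.{0} k G) (v : M.V) :
    M.ρ (th e) (M.ρ (th e) (M.ρ (th e) (M.ρ (th e) v))) = v := by
  simp only [← Module.End.mul_apply, ← map_mul]
  rw [show th e * (th e * (th e * th e)) = 1 by rw [← th4 e]; group]
  simp
lemma rho2 (M : Rep.{0} k G) (v : M.V) :
    M.ρ (ta e) (M.ρ (ta e) v) = M.ρ (th e) (M.ρ (th e) v) := by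
  simp only [← Module.End.mul_apply, ← map_mul, ta2]
lemma rhoc (M : Rep.{0} k G) (v : M.V) :
    M.ρ (ta e) (M.ρ (th e) v) = M.ρ (th e) (M.ρ (th e) (M.ρ (th e) (M.ρ (ta e) v))) := by
  simp only [← Module.End.mul_apply, ← map_mul, tath, mul_assoc]

lemma qx (M : Rep.{0} k G) : QX (X e M) (Y e M) where
  hyy v := by
    simp only [X_apply, Y_apply, map_sub, rho2]
    linear_combination (norm := (match_scalars <;> grind)) (0 : k) • rho4 e M v
  hyx v := by
    simp only [X_apply, Y_apply, map_sub, map_add, rho2, rhoc]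
    linear_combination (norm := (match_scalars <;> grind)) (0 : k) • rho4 e M v
  h4 v := by
    simp only [X_apply, Y_apply, map_sub, map_add, rho4]
    linear_combination (norm := (match_scalars <;> grind)) (0 : k) • rho4 e M v

lemma norm_eq (M : Rep.{0} k G) (v : M.V) :
    ∑ g : G, M.ρ g v = X e M (X e M (X e M (Y e M v))) := by
  rw [sum_G e]
  simp only [map_mul, Module.End.mul_apply, map_one, Module.End.one_apply, X_apply, Y_apply, map_sub]
  linear_combination (norm := (match_scalars <;> grind)) (0 : k) • rho4 e M v

variable {e}

lemma lin_X {M N : Rep.{0} k G} (f : M ⟶ N) (v : M.V) : lin f (X e M v) = X e N (lin f v) := by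
  rw [X_apply, X_apply, map_sub, lin_eqv]
lemma lin_Y {M N : Rep.{0} k G} (f : M ⟶ N) (v : M.V) : lin f (Y e M v) = Y e N (lin f v) := by
  rw [Y_apply, Y_apply, map_sub, lin_eqv]

lemma XX_apply (M : Rep.{0} k G) (v : M.V) :
    X e M (X e M v) = M.ρ (th e * th e) v + v := by
  simp only [X_apply, map_sub, map_mul, Module.End.mul_apply]
  linear_combination (norm := (match_scalars <;> grind)) (0 : k) • rho4 e M v

variable (e) in
lemma eqv_of_XY {M N : Rep.{0} k G} (f : M.V →ₗ[k] N.V) (h1 : ∀ v, f (X e M v) = X e N (f v))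
    (h2 : ∀ v, f (Y e M v) = Y e N (f v)) (g : G) (v : M.V) : f (M.ρ g v) = N.ρ g (f v) := by
  have t1 : ∀ v, f (M.ρ (th e) v) = N.ρ (th e) (f v) := by
    intro v
    have := h1 v
    simpa [X_apply, map_sub] using this
  have t2 : ∀ v, f (M.ρ (ta e) v) = N.ρ (ta e) (f v) := by
    intro v
    have := h2 v
    simpa [Y_apply, map_sub] using this
  have t1' : ∀ (n : ℕ) v, f (M.ρ (th e ^ n) v) = N.ρ (th e ^ n) (f v) := by
    intro n
    induction n with
    | zero => simp
    | succ n ih => intro v; rw [pow_succ', map_mul, Module.End.mul_apply, t1, ih, map_mul, Module.End.mul_apply]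
  have t2' : ∀ (n : ℕ) v, f (M.ρ (ta e ^ n) v) = N.ρ (ta e ^ n) (f v) := by
    intro n
    induction n with
    | zero => simp
    | succ n ih => intro v; rw [pow_succ', map_mul, Module.End.mul_apply, t2, ih, map_mul, Module.End.mul_apply]
  obtain ⟨i, j, rfl⟩ := gen e g
  simp only [map_mul, Module.End.mul_apply, t1', t2']

variable (e) in
lemma iso_of_XY {M N : Rep.{0} k G} (f : M.V ≃ₗ[k] N.V) (h1 : ∀ v, f (X e M v) = X e N (f v))
    (h2 : ∀ v, f (Y e M v) = Y e N (f v)) : Nonempty (M ≅ N) := by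
  have h := eqv_of_XY e (M := M) (N := N) f.toLinearMap h1 h2
  refine ⟨⟨mkHom f.toLinearMap h, mkHom f.symm.toLinearMap fun g v => ?_, lin_ext fun v => ?_,
    lin_ext fun v => ?_⟩⟩
  · apply f.injective
    have := h g (f.symm v)
    simp only [LinearEquiv.coe_coe, LinearEquiv.apply_symm_apply] at this ⊢
    exact this.symm
  · exact f.symm_apply_apply v
  · exact f.apply_symm_apply v

lemma rho_z_inv {M : Rep.{0} k G} {v : M.V} (hv : X e M (X e M v) = 0) :
    M.ρ (th e)⁻¹ (M.ρ (th e)⁻¹ v) = v := by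
  have h1 : M.ρ (th e * th e) v = v := by
    rw [XX_apply] at hv
    generalize M.ρ (th e * th e) v = t at *
    have h2 : (1 : k) + 1 = 0 := CharTwo.add_self_eq_zero 1
    have h3 : v + v = 0 := by rw [← one_smul k v, ← add_smul, h2, zero_smul]
    rw [← add_left_inj v, hv, h3]
  conv_lhs => rw [← h1]
  simp only [← Module.End.mul_apply, ← map_mul]
  simp

lemma tr_K {M N : Rep.{0} k G} (φ : M.V →ₗ[k] N.V) {v : M.V} (hv : X e M (X e M v) = 0) :
    ∃ u, lin (tr φ) v = X e N (X e N u) := by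
  have hz := rho_z_inv hv
  refine ⟨φ v + N.ρ (th e) (φ (M.ρ (th e)⁻¹ v)) + N.ρ (ta e) (φ (M.ρ (ta e)⁻¹ v)) +
    N.ρ (th e * ta e) (φ (M.ρ (th e * ta e)⁻¹ v)), ?_⟩
  rw [tr_apply, sum_G e, XX_apply]
  simp only [map_add, map_mul, Module.End.mul_apply, mul_inv_rev, inv_one, map_one,
    Module.End.one_apply, hz]
  abel

lemma tr_fixed {M N : Rep.{0} k G} (φ : M.V →ₗ[k] N.V) {v : M.V} (hx : X e M v = 0)
    (hy : Y e M v = 0) : lin (tr φ) v = X e N (X e N (X e N (Y e N (φ v)))) := by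
  have h : ∀ g : G, M.ρ g⁻¹ v = v := by
    intro g
    have := eqv_of_XY e (M := Rep.trivial k G k) (N := M) (LinearMap.toSpanSingleton k M.V v)
      (by
        intro a
        rw [LinearMap.toSpanSingleton_apply, LinearMap.toSpanSingleton_apply, map_smul, hx, smul_zero]
        change ((a : k) - a) • v = 0
        rw [sub_self, zero_smul]) (by
        intro a
        rw [LinearMap.toSpanSingleton_apply, LinearMap.toSpanSingleton_apply, map_smul, hy, smul_zero]
        change ((a : k) - a) • v = 0
        rw [sub_self, zero_smul]) g⁻¹ 1
    simpa using this.symm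
  rw [tr_apply, ← norm_eq]
  simp only [h]

variable (e)

/-- kernel equals image for `X²` -/
def KI (M : Rep.{0} k G) : Prop := ∀ v, X e M (X e M v) = 0 → ∃ u, v = X e M (X e M u)

/-- `w` spans kernel modulo image of `X²` -/
structure E1w (M : Rep.{0} k G) (w : M.V) : Prop where
  z : X e M (X e M w) = 0
  ni : ∀ u, w ≠ X e M (X e M u)
  K : ∀ v, X e M (X e M v) = 0 → ∃ u, ∃ μ : k, v = X e M (X e M u) + μ • w

/-- kernel mod image is one-dimensional -/
def E1 (M : Rep.{0} k G) : Prop := ∃ w, E1w e M w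
/-- even type -/
def tyK (M : Rep.{0} k G) : Prop := ∃ w, E1w e M w ∧ X e M w = 0
/-- odd type -/
def tyO (M : Rep.{0} k G) : Prop := ∃ w, E1w e M w ∧ ∃ u, w = X e M u

variable {e}

lemma KI_of_FP {P : Rep.{0} k G} (h : FP (𝟙 P)) : KI e P := by
  intro v hv
  obtain ⟨φ, hφ⟩ := h
  obtain ⟨u, hu⟩ := tr_K φ hv
  exact ⟨u, by rw [← hu, ← hφ]; rfl⟩

lemma FP_K {M N : Rep.{0} k G} {f : M ⟶ N} (h : FP f) {v : M.V} (hv : X e M (X e M v) = 0) :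
    ∃ u, lin f v = X e N (X e N u) := by
  obtain ⟨φ, rfl⟩ := h
  exact tr_K φ hv

lemma FP_K' {M N : Rep.{0} k G} {f : M ⟶ N} {g : N ⟶ M} (h : FP (f ≫ g - 𝟙 M)) {v : M.V}
    (hv : X e M (X e M v) = 0) : ∃ u, v = lin g (lin f v) + X e M (X e M u) := by
  obtain ⟨u, hu⟩ := FP_K h hv
  refine ⟨-u, ?_⟩
  simp only [lin_sub, lin_comp, lin_id] at hu
  simp only [map_neg, ← hu]
  abel

lemma KI.seq {M N : Rep.{0} k G} (h : KI e M) (hs : SEq M N) : KI e N := by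
  obtain ⟨f, g, h1, h2⟩ := hs
  intro v hv
  obtain ⟨u, hu⟩ := FP_K' h2 hv
  obtain ⟨u', hu'⟩ := h (lin g v) (by rw [← lin_X, ← lin_X, hv, map_zero])
  refine ⟨lin f u' + u, ?_⟩
  rw [hu, hu']
  simp only [lin_X, map_add]

lemma E1w.map {M N : Rep.{0} k G} {w : M.V} (h : E1w e M w) {f : M ⟶ N} {g : N ⟶ M}
    (h1 : FP (f ≫ g - 𝟙 M)) (h2 : FP (g ≫ f - 𝟙 N)) : E1w e N (lin f w) := by
  refine ⟨by rw [← lin_X, ← lin_X, h.z, map_zero], fun u hu => ?_, fun v hv => ?_⟩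
  · obtain ⟨u', hu'⟩ := FP_K' h1 h.z
    refine h.ni (lin g u + u') ?_
    rw [hu', hu]
    simp only [lin_X, map_add]
  · obtain ⟨u, hu⟩ := FP_K' h2 hv
    obtain ⟨u', μ, hu'⟩ := h.K (lin g v) (by rw [← lin_X, ← lin_X, hv, map_zero])
    refine ⟨lin f u' + u, μ, ?_⟩
    rw [hu, hu']
    simp only [lin_X, map_add, map_smul]
    abel

lemma E1.seq {M N : Rep.{0} k G} (h : E1 e M) (hs : SEq M N) : E1 e N := by
  obtain ⟨f, g, h1, h2⟩ := hs
  obtain ⟨w, hw⟩ := h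
  exact ⟨_, hw.map h1 h2⟩
lemma tyK.seq {M N : Rep.{0} k G} (h : tyK e M) (hs : SEq M N) : tyK e N := by
  obtain ⟨f, g, h1, h2⟩ := hs
  obtain ⟨w, hw, hx⟩ := h
  exact ⟨_, hw.map h1 h2, by rw [← lin_X, hx, map_zero]⟩
lemma tyO.seq {M N : Rep.{0} k G} (h : tyO e M) (hs : SEq M N) : tyO e N := by
  obtain ⟨f, g, h1, h2⟩ := hs
  obtain ⟨w, hw, u, rfl⟩ := h
  exact ⟨_, hw.map h1 h2, lin f u, by rw [← lin_X]⟩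

lemma E1w.change {M : Rep.{0} k G} {w w' : M.V} (h : E1w e M w) (hz : X e M (X e M w') = 0)
    (hn : ∀ u, w' ≠ X e M (X e M u)) : E1w e M w' := by
  refine ⟨hz, hn, fun v hv => ?_⟩
  obtain ⟨u, μ, hu⟩ := h.K w' hz
  have hμ : μ ≠ 0 := by
    rintro rfl
    exact hn u (by simpa using hu)
  obtain ⟨u', μ', hu'⟩ := h.K v hv
  have e3 : μ⁻¹ * μ = 1 := inv_mul_cancel₀ hμ
  refine ⟨u' - (μ' * μ⁻¹) • u, μ' * μ⁻¹, ?_⟩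
  rw [hu', hu]
  simp only [map_sub, map_smul]
  match_scalars <;> grind

lemma E1.ty {M : Rep.{0} k G} (h : E1 e M) : tyK e M ∨ tyO e M := by
  obtain ⟨w, hw⟩ := h
  have hq := qx e M
  obtain ⟨u, μ, hu⟩ := hw.K (X e M w) (by rw [hw.z, map_zero])
  have hμ : μ = 0 := by
    by_contra hμ
    have e2 := congrArg (X e M) hu
    rw [hw.z, map_add, map_smul, hu] at e2
    refine hw.ni (-(μ⁻¹ • u) - μ⁻¹ • (μ⁻¹ • X e M u)) ?_
    simp only [map_sub, map_neg, map_smul]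
    have e3 : μ⁻¹ * μ = 1 := inv_mul_cancel₀ hμ
    linear_combination (norm := (match_scalars <;> grind)) (-μ⁻¹ * μ⁻¹) • e2
  rw [hμ, zero_smul, add_zero] at hu
  have h0 : X e M (w - X e M u) = 0 := by rw [map_sub, hu, sub_self]
  by_cases hI : ∃ u', w - X e M u = X e M (X e M u')
  · obtain ⟨u', hu'⟩ := hI
    right
    exact ⟨w, hw, u + X e M u', by rw [map_add, ← hu']; abel⟩
  · left
    push Not at hI
    exact ⟨_, hw.change (by rw [h0, map_zero]) hI, h0⟩

lemma tyK.not_tyO {M : Rep.{0} k G} (h : tyK e M) (h' : tyO e M) : False := by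
  obtain ⟨w1, h1, hx⟩ := h
  obtain ⟨w2, h2, u, rfl⟩ := h'
  obtain ⟨b, μ, hb⟩ := h1.K _ h2.z
  obtain ⟨c, ν, hc⟩ := h1.K (u - X e M b) (by rw [map_sub, hb]; simp [hx])
  refine h2.ni (b + X e M c) ?_
  have : u = X e M b + (X e M (X e M c) + ν • w1) := by rw [← hc]; abel
  conv_lhs => rw [this]
  simp [hx]

lemma Syz.ty_aux {A M : Rep.{0} k G} (h : Syz A M) {w : M.V} (hw : E1w e M w) :
    ((∃ w', E1w e A w') ∧ (X e M w = 0 → tyO e A) ∧ (∀ u, w = X e M u → tyK e A)) := by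
  obtain ⟨P, f, g, hP, hf, hfg, hg⟩ := h.elim
  have hq := qx e P
  have hfl : ∀ q, lin g q = 0 → ∃ a, lin f a = q := fun q hq => (hfg q).1 hq
  have key : ∀ p, lin g p = w → ∀ w', lin f w' = X e P (X e P p) → E1w e A w' := by
    intro p hp w' hw'
    refine ⟨?_, fun u hu => ?_, fun v hv => ?_⟩
    · apply hf
      rw [lin_X, lin_X, hw', hq.h4, map_zero]
    · obtain ⟨q, hq'⟩ := KI_of_FP (e := e) hP (p - lin f u) (by
        simp only [map_sub, ← hw', hu, lin_X, sub_self])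
      refine hw.ni (lin g q) ?_
      have := congrArg (lin g) hq'
      rw [map_sub, hp, (hfg (lin f u)).2 ⟨u, rfl⟩, sub_zero, lin_X, lin_X] at this
      exact this
    · obtain ⟨q, hq'⟩ := KI_of_FP (e := e) hP (lin f v) (by rw [← lin_X, ← lin_X, hv, map_zero])
      obtain ⟨u, μ, hu⟩ := hw.K (lin g q) (by
        rw [← lin_X, ← lin_X, ← hq']; exact (hfg _).2 ⟨v, rfl⟩)
      obtain ⟨u', rfl⟩ := hg u
      obtain ⟨b, hb⟩ := hfl (q - μ • p - X e P (X e P u')) (by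
        simp only [map_sub, map_smul, hp, hu, lin_X]; abel)
      refine ⟨b, μ, hf ?_⟩
      simp only [map_add, map_smul, lin_X, hb, hw', hq', map_sub, hq.h4]
      abel
  have ex : ∀ p, lin g p = w → ∃ w', lin f w' = X e P (X e P p) := by
    intro p hp
    exact hfl _ (by rw [lin_X, lin_X, hp, hw.z])
  refine ⟨?_, ?_, ?_⟩
  · obtain ⟨p, hp⟩ := hg w
    obtain ⟨w', hw'⟩ := ex p hp
    exact ⟨w', key p hp w' hw'⟩
  · intro hx
    obtain ⟨p, hp⟩ := hg w
    obtain ⟨w', hw'⟩ := ex p hp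
    obtain ⟨a, ha⟩ := hfl (X e P p) (by rw [lin_X, hp, hx])
    refine ⟨w', key p hp w' hw', a, hf ?_⟩
    rw [hw', lin_X, ha]
  · intro u hu
    obtain ⟨u', rfl⟩ := hg u
    have hp : lin g (X e P u') = w := by rw [lin_X, hu]
    obtain ⟨w', hw'⟩ := ex _ hp
    refine ⟨w', key _ hp w' hw', hf ?_⟩
    rw [lin_X, hw', map_zero, hq.h4]

lemma Syz.tyK_tyO {A M : Rep.{0} k G} (h : Syz A M) (hM : tyK e M) : tyO e A := by
  obtain ⟨w, hw, hx⟩ := hM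
  exact (h.ty_aux hw).2.1 hx
lemma Syz.tyO_tyK {A M : Rep.{0} k G} (h : Syz A M) (hM : tyO e M) : tyK e A := by
  obtain ⟨w, hw, u, hu⟩ := hM
  exact (h.ty_aux hw).2.2 u hu

lemma tyK.E1 {M : Rep.{0} k G} (h : tyK e M) : E1 e M := ⟨h.choose, h.choose_spec.1⟩
lemma tyO.E1 {M : Rep.{0} k G} (h : tyO e M) : E1 e M := ⟨h.choose, h.choose_spec.1⟩

lemma Syz.E1_up {A M : Rep.{0} k G} (h : Syz A M) (hA : E1 e A) : E1 e M := by
  obtain ⟨w', hw'⟩ := hA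
  obtain ⟨P, f, g, hP, hf, hfg, hg⟩ := h.elim
  have hq := qx e P
  have hfl : ∀ q, lin g q = 0 → ∃ a, lin f a = q := fun q hq => (hfg q).1 hq
  have hgf : ∀ a, lin g (lin f a) = 0 := fun a => (hfg _).2 ⟨a, rfl⟩
  obtain ⟨p, hp⟩ := KI_of_FP (e := e) hP (lin f w') (by rw [← lin_X, ← lin_X, hw'.z, map_zero])
  refine ⟨lin g p, ?_, fun u hu => ?_, fun v hv => ?_⟩
  · rw [← lin_X, ← lin_X, ← hp, hgf]
  · obtain ⟨u', rfl⟩ := hg u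
    obtain ⟨b, hb⟩ := hfl (p - X e P (X e P u')) (by rw [map_sub, hu, lin_X, lin_X, sub_self])
    refine hw'.ni b (hf ?_)
    rw [lin_X, lin_X, hb, map_sub, map_sub, hq.h4, hp, sub_zero]
  · obtain ⟨q, rfl⟩ := hg v
    obtain ⟨a, ha⟩ := hfl (X e P (X e P q)) (by rw [lin_X, lin_X, hv])
    obtain ⟨b, μ, rfl⟩ := hw'.K a (hf (by rw [lin_X, lin_X, ha, hq.h4, map_zero]))
    obtain ⟨r, hr⟩ := KI_of_FP (e := e) hP (q - lin f b - μ • p) (by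
      simp only [map_sub, map_smul, ← hp, ← ha, map_add, lin_X]; abel)
    refine ⟨lin g r, μ, ?_⟩
    have := congrArg (lin g) hr
    simp only [map_sub, map_smul, hgf, lin_X] at this
    rw [← this]
    abel

lemma Syz.tyO_up {A M : Rep.{0} k G} (h : Syz A M) (hA : tyO e A) : tyK e M := by
  rcases (h.E1_up hA.E1).ty with h' | h'
  · exact h'
  · exact ((h.tyO_tyK h').not_tyO hA).elim

end q8
end QE

namespace QE
section strip
variable {k G : Type} [Field k] [Group G] [Fintype G]

/-- kernel of a morphism -/
abbrev KerRep {M N : Rep.{0} k G} (f : M ⟶ N) : Rep.{0} k G :=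
  Rep.subrepresentation M (LinearMap.ker (lin f)) (by
    intro g v hv
    simp only [Submodule.mem_comap, LinearMap.mem_ker] at hv ⊢
    rw [lin_eqv, hv, map_zero])

/-- inclusion of the kernel -/
abbrev kerι {M N : Rep.{0} k G} (f : M ⟶ N) : KerRep f ⟶ M :=
  mkHom (M := KerRep f) (LinearMap.ker (lin f)).subtype (fun _ _ => rfl)

lemma kerι_inj {M N : Rep.{0} k G} (f : M ⟶ N) : Function.Injective (lin (kerι f)) :=
  Subtype.val_injective

lemma kerι_exact {M N : Rep.{0} k G} (f : M ⟶ N) : Function.Exact (lin (kerι f)) (lin f) :=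
  fun v => ⟨fun h => ⟨⟨v, h⟩, rfl⟩, fun ⟨u, hu⟩ => hu ▸ u.2⟩

lemma Syz.ker {P M : Rep.{0} k G} (hP : FP (𝟙 P)) (g : P ⟶ M) (hg : Function.Surjective (lin g)) :
    Syz (KerRep g) M :=
  Syz.mk' hP (kerι g) g (kerι_inj g) (kerι_exact g) hg

lemma SEq.ker {M Q : Rep.{0} k G} (hQ : FP (𝟙 Q)) (f : M ⟶ Q) (i : Q ⟶ M)
    (hb : Function.Bijective (lin (i ≫ f))) : SEq M (KerRep f) := by
  let E := LinearEquiv.ofBijective (lin (i ≫ f)) hb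
  have hE : ∀ v, E v = lin f (lin i v) := fun v => rfl
  have hE' : ∀ v, lin f (lin i (E.symm v)) = v := fun v => E.apply_symm_apply v
  let s : Q ⟶ Q := mkHom E.symm.toLinearMap (by
    intro g v
    apply E.injective
    simp only [LinearEquiv.coe_coe, hE, lin_eqv, hE'])
  have hs : ∀ v, lin f (lin i (lin s v)) = v := hE'
  let π : M ⟶ KerRep f := mkHom (N := KerRep f)
    (LinearMap.codRestrict (LinearMap.ker (lin f)) (lin (𝟙 M - f ≫ s ≫ i)) (by
      intro v
      simp only [LinearMap.mem_ker, lin_sub, lin_comp, lin_id, map_sub, hs, sub_self]))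
    (by
      intro g v
      apply Subtype.ext
      exact lin_eqv (𝟙 M - f ≫ s ≫ i) g v)
  have hπ : ∀ v, lin (kerι f) (lin π v) = v - lin i (lin s (lin f v)) := by
    intro v
    change lin (𝟙 M - f ≫ s ≫ i) v = _
    simp
  refine ⟨π, kerι f, ?_, ?_⟩
  · have : π ≫ kerι f - 𝟙 M = -(f ≫ (s ≫ i)) := by
      apply lin_ext; intro v
      rw [lin_sub, lin_comp, hπ]
      simp
    rw [this]
    exact (FP.of_factor hQ f (s ≫ i)).neg
  · have : kerι f ≫ π - 𝟙 (KerRep f) = 0 := by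
      apply lin_ext; intro v
      apply kerι_inj
      rw [lin_sub, lin_comp, lin_zero, map_sub, hπ, map_zero]
      have : lin f (lin (kerι f) v) = 0 := v.2
      rw [this]
      simp
    rw [this]
    exact FP.zero

variable [CharP k 2] {e : G ≃* QuaternionGroup 2}

lemma fixed_of_XY {M : Rep.{0} k G} {v : M.V} (hx : X e M v = 0)
    (hy : Y e M v = 0) (g : G) : M.ρ g v = v := by
  have := eqv_of_XY e (M := Rep.trivial k G k) (N := M) (LinearMap.toSpanSingleton k M.V v)
    (by
      intro a
      rw [LinearMap.toSpanSingleton_apply, LinearMap.toSpanSingleton_apply, map_smul, hx, smul_zero]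
      change ((a : k) - a) • v = 0
      rw [sub_self, zero_smul]) (by
      intro a
      rw [LinearMap.toSpanSingleton_apply, LinearMap.toSpanSingleton_apply, map_smul, hy, smul_zero]
      change ((a : k) - a) • v = 0
      rw [sub_self, zero_smul]) g 1
  simpa using this.symm

lemma QX.fixed_inj {V : Type} [AddCommGroup V] [Module k V] {x y : V →ₗ[k] V} (h : QX x y)
    (S : Submodule k V) (hSx : ∀ v ∈ S, x v ∈ S) (hSy : ∀ v ∈ S, y v ∈ S)
    (hS : ∀ v ∈ S, x v = 0 → y v = 0 → v = 0) : ∀ v ∈ S, v = 0 := by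
  have A : ∀ u ∈ S, x u = 0 → u = 0 := by
    intro u hu hx
    have ht := h.hyx u
    simp only [hx, map_zero, map_add, zero_add] at ht
    have e1 := congrArg x ht
    have e2 := congrArg x e1
    have e3 := congrArg x e2
    simp only [map_zero, map_add, h.h4, add_zero] at e1 e2 e3
    have t1 : x (x (x (y u))) = 0 := by simpa using e2.symm
    have t2 : x (x (y u)) = 0 := by simpa [t1] using e1.symm
    have t3 : x (y u) = 0 := by simpa [t1, t2] using ht.symm
    have : y u = 0 := hS _ (hSy u hu) t3 (by rw [h.hyy, hx, map_zero])
    exact hS u hu hx this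
  intro v hv
  exact A _ hv (A _ (hSx _ hv) (A _ (hSx _ (hSx _ hv)) (A _ (hSx _ (hSx _ (hSx _ hv))) (h.h4 v))))

lemma inj_of_fixed {M N : Rep.{0} k G} (f : M ⟶ N)
    (hf : ∀ v, X e M v = 0 → Y e M v = 0 → lin f v = 0 → v = 0) : Function.Injective (lin f) := by
  rw [← LinearMap.ker_eq_bot, Submodule.eq_bot_iff]
  refine (qx e M).fixed_inj _ ?_ ?_ ?_
  · intro v hv
    rw [LinearMap.mem_ker] at hv ⊢
    rw [lin_X, hv, map_zero]
  · intro v hv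
    rw [LinearMap.mem_ker] at hv ⊢
    rw [lin_Y, hv, map_zero]
  · intro v hv hx hy
    exact hf v hx hy hv

variable (e) in
/-- the norm vanishes -/
def NZ (M : Rep.{0} k G) : Prop := ∀ v, X e M (X e M (X e M (Y e M v))) = 0

lemma SEq.inj {M N : Rep.{0} k G} (h : SEq M N) (hM : NZ e M) :
    ∃ f : M ⟶ N, Function.Injective (lin f) := by
  obtain ⟨f, g, ⟨φ, h1⟩, h2⟩ := h
  refine ⟨f, inj_of_fixed (e := e) f fun v hx hy hf => ?_⟩
  have := congrArg (fun q => lin q v) h1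
  simp only [lin_sub, lin_comp, lin_id, hf, map_zero, zero_sub, tr_fixed φ hx hy] at this
  rw [hM] at this
  exact neg_eq_zero.1 this

lemma SEq.finrank_le {M N : Rep.{0} k G} (h : SEq M N) (hM : NZ e M) [FiniteDimensional k N.V] :
    Module.finrank k M.V ≤ Module.finrank k N.V := by
  obtain ⟨f, hf⟩ := h.inj hM
  exact LinearMap.finrank_le_finrank_of_injective hf

/-- map to a coinduced module -/
def coev {M : Rep.{0} k G} (φ : M.V →ₗ[k] k) : M ⟶ Ind (Rep.trivial k G k) :=
  mkHom (N := Ind (Rep.trivial k G k)) (LinearMap.pi fun h => φ ∘ₗ M.ρ h⁻¹) (by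
    intro g v
    funext h
    change φ (M.ρ h⁻¹ (M.ρ g v)) = φ (M.ρ (g⁻¹ * h)⁻¹ v)
    rw [← Module.End.mul_apply, ← map_mul]
    simp)

lemma coev_apply {M : Rep.{0} k G} (φ : M.V →ₗ[k] k) (v : M.V) (h : G) :
    (lin (coev φ) v : G → k) h = φ (M.ρ h⁻¹ v) := rfl

variable (e) in
theorem strip : ∀ (n : ℕ) (M : Rep.{0} k G), FiniteDimensional k M.V → Module.finrank k M.V = n →
    ∃ M' : Rep.{0} k G, FiniteDimensional k M'.V ∧ SEq M M' ∧ NZ e M' := by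
  intro n
  induction n using Nat.strong_induction_on with
  | _ n ih =>
    intro M hfd hn
    by_cases hN : NZ e M
    · exact ⟨M, hfd, SEq.refl M, hN⟩
    · unfold NZ at hN
      push Not at hN
      obtain ⟨m, hm⟩ := hN
      obtain ⟨φ, hφ⟩ := 
        (Module.forall_dual_apply_eq_zero_iff k (X e M (X e M (X e M (Y e M m))))).not.2 hm |> not_forall.1
      rw [← norm_eq] at hφ
      have hb : Function.Injective (lin (fromInd (M := Rep.trivial k G k)
          (LinearMap.toSpanSingleton k M.V m) ≫ coev φ)) := by
        refine inj_of_fixed (e := e) _ fun F hx hy hF => ?_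
        have hc : ∀ g, (F : G → k) g = (F : G → k) 1 := by
          intro g
          have := congrFun (fixed_of_XY hx hy g) g
          change (F : G → k) (g⁻¹ * g) = _ at this
          rw [← this, inv_mul_cancel]
        have h1 : lin (fromInd (M := Rep.trivial k G k) (LinearMap.toSpanSingleton k M.V m)) F =
            (F : G → k) 1 • ∑ g : G, M.ρ g m := by
          rw [fromInd_apply, Finset.smul_sum]
          refine Finset.sum_congr rfl fun g _ => ?_
          rw [← hc g, ← map_smul]
          rfl
        have h2 := congrFun hF 1
        rw [lin_comp, h1] at h2
        have h3 : φ (M.ρ 1⁻¹ ((F : G → k) 1 • ∑ g : G, M.ρ g m)) = 0 := h2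
        rw [inv_one, map_one, Module.End.one_apply, map_smul, smul_eq_mul] at h3
        have h4 : (F : G → k) 1 = 0 := (mul_eq_zero.1 h3).resolve_right hφ
        funext g
        exact (hc g).trans h4
      have hfI : FiniteDimensional k (Ind (Rep.trivial k G k)).V :=
        inferInstanceAs (FiniteDimensional k (G → k))
      have hb' : Function.Bijective (lin (fromInd (M := Rep.trivial k G k)
          (LinearMap.toSpanSingleton k M.V m) ≫ coev φ)) :=
        ⟨hb, LinearMap.injective_iff_surjective.1 hb⟩
      have hs := SEq.ker (Ind_FP _) (coev φ) _ hb'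
      have hlt : Module.finrank k (KerRep (coev φ)).V < n := by
        rw [← hn]
        apply Submodule.finrank_lt
        intro htop
        apply hm
        have h0 : m ∈ LinearMap.ker (lin (coev φ)) := htop ▸ Submodule.mem_top
        exfalso
        apply hφ
        rw [map_sum]
        refine Finset.sum_eq_zero fun g _ => ?_
        have := congrFun (LinearMap.mem_ker.1 h0) g⁻¹
        rw [coev_apply, inv_inv] at this
        exact this
      obtain ⟨M', h1, h2, h3⟩ := ih _ hlt (KerRep (coev φ)) inferInstance rfl
      exact ⟨M', h1, hs.trans h2, h3⟩

lemma FP_of_SEq_zero {M N : Rep.{0} k G} (h : SEq M N) (hN : ∀ v : N.V, v = 0) : FP (𝟙 M) := by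
  obtain ⟨f, g, h1, h2⟩ := h
  have : f ≫ g - 𝟙 M = - 𝟙 M := by
    apply lin_ext; intro v
    rw [lin_sub, lin_comp, hN (lin f v), map_zero, lin_neg, zero_sub]
  rw [this] at h1
  simpa using h1.neg

/-- Chouinard-type criterion -/
theorem chouinard {o : k} (ho : o * o = o + 1) (M : Rep.{0} k G) [FiniteDimensional k M.V]
    (h : KI e M) : FP (𝟙 M) := by
  obtain ⟨M', h1, h2, h3⟩ := strip e _ M inferInstance rfl
  exact FP_of_SEq_zero h2 (chouinard_zero (qx e M') h3 ho (h.seq h2))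

end strip
end QE

namespace QE
section endo
variable {k G : Type} [Field k] [Group G] [Fintype G]

lemma SEq.biprod_proj {M P : Rep.{0} k G} (hP : FP (𝟙 P)) : SEq (M ⊞ P) M := by
  refine ⟨biprod.fst, biprod.inl, ?_, ?_⟩
  · have : (biprod.fst ≫ biprod.inl - 𝟙 (M ⊞ P) : M ⊞ P ⟶ M ⊞ P) = -(biprod.snd ≫ biprod.inr) := by
      rw [← biprod.total]; abel
    rw [this]
    exact (FP.of_factor hP _ _).neg
  · simp [FP.zero]

lemma split_iso {M Q : Rep.{0} k G} (f : M ⟶ Q) (i : Q ⟶ M) (h : i ≫ f = 𝟙 Q) :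
    Nonempty (M ≅ Q ⊞ KerRep f) := by
  have hfi : ∀ v, lin f (lin i v) = v := fun v => congrArg (fun q => lin q v) h
  let π : M ⟶ KerRep f := mkHom (N := KerRep f)
    (LinearMap.codRestrict (LinearMap.ker (lin f)) (lin (𝟙 M - f ≫ i)) (by
      intro v
      simp only [LinearMap.mem_ker, lin_sub, lin_comp, lin_id, map_sub, hfi, sub_self]))
    (by
      intro g v
      apply Subtype.ext
      exact lin_eqv (𝟙 M - f ≫ i) g v)
  have hπ : π ≫ kerι f = 𝟙 M - f ≫ i := rfl
  have hι : kerι f ≫ f = 0 := lin_ext fun v => v.2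
  have hm : ∀ {A : Rep.{0} k G} (a b : A ⟶ KerRep f), a ≫ kerι f = b ≫ kerι f → a = b := by
    intro A a b hab
    apply lin_ext; intro v
    exact kerι_inj f (congrArg (fun q => lin q v) hab)
  refine ⟨⟨biprod.lift f π, biprod.desc i (kerι f), ?_, ?_⟩⟩
  · rw [biprod.lift_desc, hπ]; abel
  · have h1 : i ≫ π = 0 := hm _ _ (by
      rw [Category.assoc, hπ, Preadditive.comp_sub, ← Category.assoc, h]; simp)
    have h2 : kerι f ≫ π = 𝟙 _ := hm _ _ (by
      rw [Category.assoc, hπ, Preadditive.comp_sub, ← Category.assoc, hι]; simp)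
    apply biprod.hom_ext' <;> apply biprod.hom_ext <;> simp [h, h1, h2, hι]

variable [CharP k 2] {e : G ≃* QuaternionGroup 2}

variable (e) in
lemma E1w_triv : E1w e (Rep.trivial k G k) (1 : k) := by
  have hX : ∀ v, X e (Rep.trivial k G k) v = 0 := fun v => sub_self (v : k)
  refine ⟨by rw [hX], fun u hu => ?_, fun v _ => ⟨0, (v : k), ?_⟩⟩
  · rw [hX] at hu
    exact one_ne_zero (α := k) hu
  · rw [hX, zero_add]
    exact (mul_one (v : k)).symm

variable (e) in
lemma tyK_triv : tyK e (Rep.trivial k G k) := ⟨_, E1w_triv e, sub_self (1 : k)⟩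

lemma char2_eq {V : Type} [AddCommGroup V] [Module k V] {a b : V} (h : a + b = 0) : b = a := by
  have h2 : (1 : k) + 1 = 0 := CharTwo.add_self_eq_zero 1
  have h3 : a + a = 0 := by rw [← one_smul k a, ← add_smul, h2, zero_smul]
  rw [← add_right_inj a, h, h3]

/-- endomorphism module -/
abbrev En (M : Rep.{0} k G) : Rep.{0} k G := Rep.of (M.ρ.linHom M.ρ)

lemma rho_z (M : Rep.{0} k G) (v : M.V) : M.ρ (th e * th e) v = X e M (X e M v) + v := by
  rw [XX_apply, add_assoc]
  have h2 : (1 : k) + 1 = 0 := CharTwo.add_self_eq_zero 1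
  have h3 : v + v = 0 := by rw [← one_smul k v, ← add_smul, h2, zero_smul]
  rw [h3, add_zero]

lemma XXE (M : Rep.{0} k G) (q : M.V →ₗ[k] M.V) (u : M.V) :
    (X e (En M) (X e (En M) q) : M.V →ₗ[k] M.V) u =
      X e M (X e M (q u)) + q (X e M (X e M u)) + X e M (X e M (q (X e M (X e M u)))) := by
  rw [XX_apply]
  change M.ρ (th e * th e) (q (M.ρ (th e * th e)⁻¹ u)) + q u = _
  have : (th e * th e)⁻¹ = th e * th e := inv_eq_of_mul_eq_one_left (th4 e)
  rw [this, rho_z, rho_z]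
  simp only [map_add]
  linear_combination (norm := (match_scalars <;> grind)) (0 : k) • rho4 e M u

lemma even_of_KI {M : Rep.{0} k G} [FiniteDimensional k M.V] (h : KI e M) :
    Even (Module.finrank k M.V) := by
  have hr : LinearMap.range (X e M ∘ₗ X e M) = LinearMap.ker (X e M ∘ₗ X e M) := by
    apply le_antisymm
    · rintro _ ⟨u, rfl⟩
      exact (qx e M).h4 u
    · intro v hv
      obtain ⟨u, hu⟩ := h v hv
      exact ⟨u, hu.symm⟩
  have := LinearMap.finrank_range_add_finrank_ker (X e M ∘ₗ X e M)
  rw [hr] at this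
  exact ⟨_, this.symm⟩

lemma E1w.odd {M : Rep.{0} k G} [FiniteDimensional k M.V] {w : M.V} (h : E1w e M w) :
    Odd (Module.finrank k M.V) := by
  set D := X e M ∘ₗ X e M with hD
  have hr : LinearMap.ker D = LinearMap.range D ⊔ k ∙ w := by
    apply le_antisymm
    · intro v hv
      obtain ⟨u, μ, hu⟩ := h.K v hv
      rw [hu]
      exact Submodule.add_mem_sup ⟨u, rfl⟩ (Submodule.smul_mem _ _ (Submodule.mem_span_singleton_self w))
    · apply sup_le
      · rintro _ ⟨u, rfl⟩
        exact (qx e M).h4 u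
      · rw [Submodule.span_singleton_le_iff_mem]
        exact h.z
  have hw : w ∉ LinearMap.range D := by
    rintro ⟨u, hu⟩
    exact h.ni u hu.symm
  have h1 := LinearMap.finrank_range_add_finrank_ker D
  have h2 := Submodule.finrank_sup_add_finrank_inf_eq (LinearMap.range D) (k ∙ w)
  have hw0 : w ≠ 0 := fun h0 => hw (h0 ▸ Submodule.zero_mem _)
  have h3 : LinearMap.range D ⊓ (k ∙ w) = ⊥ := by
    rw [← disjoint_iff]
    exact (Submodule.disjoint_span_singleton' hw0).2 hw
  rw [h3, finrank_bot, finrank_span_singleton hw0, ← hr] at h2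
  exact ⟨Module.finrank k (LinearMap.range D), by omega⟩

lemma E1_of_endotrivial {M : Rep.{0} k G} (h : IsEndotrivial M) : E1 e M := by
  obtain ⟨hfd, P, hP, ⟨i⟩⟩ := h
  rw [projective_iff] at hP
  have hs : SEq (En M) (Rep.trivial k G k) := (SEq.of_iso i).trans (SEq.biprod_proj hP)
  have hfE : FiniteDimensional k (En M).V := inferInstanceAs (FiniteDimensional k (M.V →ₗ[k] M.V))
  obtain ⟨w0, hw0⟩ := (E1.seq ⟨_, E1w_triv e⟩ hs.symm : E1 e (En M))
  have hodd : Odd (Module.finrank k M.V) := by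
    have := hw0.odd
    have h2 : Module.finrank k (En M).V = Module.finrank k M.V * Module.finrank k M.V :=
      Module.finrank_linearMap k k M.V M.V
    rw [h2] at this
    exact (Nat.odd_mul.1 this).1
  have hnK : ¬ KI e M := fun hK => (Nat.not_even_iff_odd.2 hodd) (even_of_KI hK)
  unfold KI at hnK
  push Not at hnK
  obtain ⟨w, hwz, hwn⟩ := hnK
  have hid : E1w e (En M) (LinearMap.id : M.V →ₗ[k] M.V) := by
    refine hw0.change ?_ ?_
    · apply LinearMap.ext; intro u
      rw [XXE]
      change _ = (0 : M.V)
      simp only [LinearMap.id_apply, (qx e M).h4, add_zero]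
      linear_combination (norm := (match_scalars <;> grind)) (0 : k) • rho4 e M u
    · intro u hu
      refine hwn ((u : M.V →ₗ[k] M.V) w) ?_
      have := congrArg (fun q : M.V →ₗ[k] M.V => q w) hu
      simp only at this
      rw [XXE, hwz] at this
      simpa using this
  refine ⟨w, hwz, hwn, fun v hv => ?_⟩
  have hw' : w ∉ LinearMap.range (X e M ∘ₗ X e M) := by
    rintro ⟨u, hu⟩
    exact hwn u hu.symm
  obtain ⟨φ, hφ, hφI⟩ := Submodule.exists_le_ker_of_notMem hw'
  have hφ0 : ∀ u, φ (X e M (X e M u)) = 0 := fun u => hφI ⟨u, rfl⟩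
  obtain ⟨q, μ, hq⟩ := hid.K (LinearMap.toSpanSingleton k M.V v ∘ₗ φ : M.V →ₗ[k] M.V) (by
    apply LinearMap.ext; intro u
    rw [XXE]
    change _ = (0 : M.V)
    simp [hφ0, hv])
  have := congrArg (fun q : M.V →ₗ[k] M.V => q w) hq
  simp only [LinearMap.comp_apply, LinearMap.toSpanSingleton_apply] at this
  change φ w • v = (X e (En M) (X e (En M) q) : M.V →ₗ[k] M.V) w + μ • w at this
  rw [XXE, hwz] at this
  simp only [map_zero, add_zero] at this
  refine ⟨(φ w)⁻¹ • (q : M.V →ₗ[k] M.V) w, (φ w)⁻¹ * μ, ?_⟩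
  rw [← inv_smul_smul₀ hφ v, this]
  simp only [map_smul, smul_add, mul_smul]

lemma exists_ginv {V : Type} [AddCommGroup V] [Module k V] (D : V →ₗ[k] V) :
    ∃ s : V →ₗ[k] V, ∀ v, D (s (D v)) = D v := by
  obtain ⟨t, ht⟩ := D.rangeRestrict.exists_rightInverse_of_surjective D.range_rangeRestrict
  obtain ⟨s, hs⟩ := LinearMap.exists_extend t
  refine ⟨s, fun v => ?_⟩
  have h1 : s (D v) = t ⟨D v, v, rfl⟩ := congrArg (fun q => q ⟨D v, v, rfl⟩) hs
  have h2 := congrArg (fun q => (q ⟨D v, v, rfl⟩ : LinearMap.range D).1) ht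
  rw [h1]
  exact h2

lemma En_K {M : Rep.{0} k G} {w : M.V} (h : E1w e M w) (f : M.V →ₗ[k] M.V)
    (hf : ∀ v, f (X e M (X e M v)) = X e M (X e M (f v))) :
    ∃ (q : M.V →ₗ[k] M.V) (μ : k), ∀ u, f u = (X e (En M) (X e (En M) q) : M.V →ₗ[k] M.V) u + μ • u := by
  obtain ⟨b, μ, hb⟩ := h.K (f w) (by rw [← hf, h.z, map_zero])
  obtain ⟨D, hD⟩ : ∃ D : M.V →ₗ[k] M.V, ∀ v, X e M (X e M v) = D v := ⟨X e M ∘ₗ X e M, fun _ => rfl⟩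
  have hDD : ∀ v, D (D v) = 0 := fun v => by rw [← hD, ← hD, (qx e M).h4]
  have hK := h.K
  have hz := h.z
  simp only [hD] at hb hf hK hz
  obtain ⟨s, hs⟩ := exists_ginv D
  obtain ⟨f', hf'⟩ : ∃ f' : M.V →ₗ[k] M.V, ∀ v, f' v = f v - μ • v :=
    ⟨f - μ • LinearMap.id, fun v => by simp⟩
  have hfD : ∀ v, f' (D v) = D (f' v) := fun v => by rw [hf', hf', hf, map_sub, map_smul]
  have hfK : ∀ v, D v = 0 → D (s (f' v)) = f' v := by
    intro v hv
    obtain ⟨a, l, rfl⟩ := hK v hv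
    have : f' (D a + l • w) = D (f' a + l • b) := by
      rw [map_add, map_add, hfD, map_smul, map_smul, hf', hf' w, hb]; simp
    rw [this, hs]
  refine ⟨f' ∘ₗ (s + D ∘ₗ s) + s ∘ₗ f' ∘ₗ (LinearMap.id - D ∘ₗ s - s ∘ₗ D), μ, fun u => ?_⟩
  rw [XXE]
  simp only [hD, LinearMap.add_apply, LinearMap.sub_apply, LinearMap.comp_apply, LinearMap.id_apply,
    map_add, map_sub, hs, hDD, ← hfD, map_zero]
  have := hfK (u - D (s u) - s (D u)) (by simp [hs, hDD])
  simp only [map_sub] at this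
  have h2 : f u = f' u + μ • u := by rw [hf']; abel
  rw [h2]
  linear_combination (norm := (match_scalars <;> grind)) this

theorem endotrivial_of_E1 {o : k} (ho : o * o = o + 1) {M : Rep.{0} k G} (hfd : FiniteDimensional k M.V)
    (h : E1 e M) : IsEndotrivial M := by
  obtain ⟨w, hw⟩ := h
  have hodd : (Module.finrank k M.V : k) = 1 := by
    obtain ⟨n, hn⟩ := hw.odd
    rw [hn]
    have := CharTwo.two_eq_zero (R := k)
    push_cast
    rw [this]; simp
  refine ⟨hfd, ?_⟩
  let t : En M ⟶ Rep.trivial k G k := mkHom (M := En M) (N := Rep.trivial k G k)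
    (LinearMap.trace k M.V) (by
      intro g f
      change LinearMap.trace k M.V (M.ρ g ∘ₗ f ∘ₗ M.ρ g⁻¹) = LinearMap.trace k M.V f
      rw [LinearMap.trace_comp_comm', LinearMap.comp_assoc]
      congr 1
      ext v
      simp [← Module.End.mul_apply, ← map_mul])
  have ht : ∀ f : M.V →ₗ[k] M.V, lin t f = LinearMap.trace k M.V f := fun _ => rfl
  let i : Rep.trivial k G k ⟶ En M := mkHom (M := Rep.trivial k G k) (N := En M)
    (LinearMap.toSpanSingleton k (M.V →ₗ[k] M.V) LinearMap.id) (by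
      intro g a
      apply LinearMap.ext; intro v
      change (a : k) • v = M.ρ g ((a : k) • M.ρ g⁻¹ v)
      rw [map_smul, ← Module.End.mul_apply, ← map_mul]
      simp)
  have hti : i ≫ t = 𝟙 _ := by
    apply lin_ext; intro a
    change LinearMap.trace k M.V ((a : k) • LinearMap.id) = a
    rw [map_smul, LinearMap.trace_id, hodd]
    exact mul_one (a : k)
  refine ⟨KerRep t, ?_, split_iso t i hti⟩
  rw [projective_iff]
  have hfE : FiniteDimensional k (En M).V := inferInstanceAs (FiniteDimensional k (M.V →ₗ[k] M.V))
  refine chouinard (e := e) ho _ fun f hf => ?_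
  have hX0 : ∀ q : M.V →ₗ[k] M.V, LinearMap.trace k M.V (X e (En M) (X e (En M) q) : M.V →ₗ[k] M.V) = 0 := by
    intro q
    have h1 := lin_X (e := e) t (X e (En M) q)
    exact h1.trans (sub_self (G := k) _)
  have hf' : X e (En M) (X e (En M) (lin (kerι t) f)) = 0 := by
    rw [← lin_X, ← lin_X, hf, map_zero]
  obtain ⟨F, hF⟩ : ∃ F : M.V →ₗ[k] M.V, F = lin (kerι t) f := ⟨_, rfl⟩
  have hFt : LinearMap.trace k M.V F = 0 := by rw [hF]; exact f.2
  have hcomm : ∀ v, F (X e M (X e M v)) = X e M (X e M (F v)) := by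
    have h1 : ∀ u, X e M (X e M (F u)) + F (X e M (X e M u)) + X e M (X e M (F (X e M (X e M u)))) = 0 := by
      intro u
      rw [← XXE, hF, hf']; rfl
    intro v
    have h2 := h1 v
    have h3 := congrArg (fun t => X e M (X e M t)) h2
    simp only [map_add, (qx e M).h4, map_zero, zero_add, add_zero] at h3
    rw [h3, add_zero] at h2
    exact char2_eq (k := k) h2
  obtain ⟨q, μ, hq⟩ := En_K hw F hcomm
  have hq' : F = (X e (En M) (X e (En M) q) : M.V →ₗ[k] M.V) + μ • LinearMap.id :=
    LinearMap.ext hq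
  have hμ : μ = 0 := by
    have := congrArg (LinearMap.trace k M.V) hq'
    rw [hFt, map_add, hX0, map_smul, LinearMap.trace_id, hodd] at this
    simpa using this.symm
  rw [hμ, zero_smul, add_zero] at hq'
  obtain ⟨q', hq''⟩ : ∃ q' : M.V →ₗ[k] M.V, q' = q - LinearMap.trace k M.V q • LinearMap.id := ⟨_, rfl⟩
  have hqt : lin t q' = 0 := by
    rw [ht, hq'', map_sub, map_smul, LinearMap.trace_id, hodd]
    simp
  refine ⟨⟨q', hqt⟩, kerι_inj t ?_⟩
  rw [lin_X, lin_X, ← hF, hq']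
  have h5 : lin (kerι t) ⟨q', hqt⟩ = q' := rfl
  rw [h5]
  apply LinearMap.ext; intro u
  rw [XXE, XXE, hq'']
  simp only [LinearMap.sub_apply, LinearMap.smul_apply, LinearMap.id_apply, map_sub, map_smul, (qx e M).h4]
  linear_combination (norm := (match_scalars <;> grind)) (0 : k) • rho4 e M u

theorem endotrivial_iff {o : k} (ho : o * o = o + 1) {M : Rep.{0} k G} :
    IsEndotrivial M ↔ FiniteDimensional k M.V ∧ E1 e M :=
  ⟨fun h => ⟨h.1, E1_of_endotrivial h⟩, fun h => endotrivial_of_E1 ho h.1 h.2⟩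

end endo
end QE

namespace QE
section build
variable {k G : Type} [Field k] [CharP k 2]

/-- The monoid homomorphism out of `Q₈` given by generators and relations. -/
def qlift {R : Type} [Monoid R] (A B : R) (hA : A ^ 4 = 1) (hB : B * B = A ^ 2)
    (hBA : B * A = A ^ 3 * B) : QuaternionGroup 2 →* R :=
  have hP : ∀ i j : ZMod 4, A ^ (i + j).val = A ^ i.val * A ^ j.val := by
    intro i j
    rw [ZMod.val_add, ← pow_add, ← pow_eq_pow_mod _ hA]
  have h3 : A ^ 3 * (A ^ 3 * (A ^ 3 * B)) = A * B := by
    rw [← mul_assoc, ← mul_assoc, ← pow_add, ← pow_add, pow_eq_pow_mod _ hA]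
    simp
  have c1 : A * B = B * A ^ 3 := by
    rw [← h3, ← hBA, ← mul_assoc (A ^ 3) B A, ← hBA, ← mul_assoc (A ^ 3), ← mul_assoc (A ^ 3), ← hBA]
    simp [pow_succ, mul_assoc]
  have c2 : A ^ 2 * B = B * A ^ 2 := by rw [← hB, mul_assoc]
  have hQ : ∀ i : ZMod 4, A ^ i.val * B = B * A ^ (-i).val := by
    intro i
    fin_cases i
    · change A ^ 0 * B = B * A ^ 0
      simp
    · change A ^ 1 * B = B * A ^ 3
      rw [pow_one, c1]
    · change A ^ 2 * B = B * A ^ 2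
      exact c2
    · change A ^ 3 * B = B * A ^ 1
      rw [pow_one, hBA]
  { toFun := fun q => match q with
      | .a i => A ^ (ZMod.val (n := 4) i)
      | .xa i => B * A ^ (ZMod.val (n := 4) i)
    map_one' := by
      change A ^ (0 : ℕ) = 1
      exact pow_zero A
    map_mul' := by
      rintro (i | i) (j | j)
      · exact hP i j
      · change B * A ^ (ZMod.val (n := 4) (j - i)) = A ^ (ZMod.val (n := 4) i) * (B * A ^ (ZMod.val (n := 4) j))
        rw [← mul_assoc, hQ, mul_assoc, ← hP, sub_eq_neg_add]
      · change B * A ^ (ZMod.val (n := 4) (i + j)) = B * A ^ (ZMod.val (n := 4) i) * A ^ (ZMod.val (n := 4) j)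
        rw [hP, mul_assoc]
      · change A ^ (ZMod.val (n := 4) (2 + j - i)) = B * A ^ (ZMod.val (n := 4) i) * (B * A ^ (ZMod.val (n := 4) j))
        rw [mul_assoc B, ← mul_assoc (A ^ _) B, hQ, mul_assoc B, ← mul_assoc B, hB, ← hP,
          show A ^ 2 = A ^ (ZMod.val (n := 4) 2) from rfl, ← hP]
        congr 2
        ring }

variable [Group G] [Fintype G] (e : G ≃* QuaternionGroup 2) {V : Type} [AddCommGroup V] [Module k V]

lemma QX.rA {x y : V →ₗ[k] V} (h : QX x y) : (1 + x : Module.End k V) ^ 4 = 1 := by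
  apply LinearMap.ext; intro v
  simp only [pow_succ, pow_zero, one_mul, Module.End.mul_apply, LinearMap.add_apply, Module.End.one_apply,
    map_add, h.h4, h.hyy]
  linear_combination (norm := (match_scalars <;> grind)) (0 : k) • h.h4 v
lemma QX.rB {x y : V →ₗ[k] V} (h : QX x y) : (1 + y : Module.End k V) * (1 + y) = (1 + x) ^ 2 := by
  apply LinearMap.ext; intro v
  simp only [pow_succ, pow_zero, one_mul, Module.End.mul_apply, LinearMap.add_apply, Module.End.one_apply,
    map_add, h.h4, h.hyy]
  linear_combination (norm := (match_scalars <;> grind)) (0 : k) • h.h4 v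
lemma QX.rBA {x y : V →ₗ[k] V} (h : QX x y) :
    (1 + y : Module.End k V) * (1 + x) = (1 + x) ^ 3 * (1 + y) := by
  apply LinearMap.ext; intro v
  simp only [pow_succ, pow_zero, one_mul, Module.End.mul_apply, LinearMap.add_apply, Module.End.one_apply,
    map_add, h.h4, h.hyy, h.hyx]
  linear_combination (norm := (match_scalars <;> grind)) (0 : k) • h.h4 v

/-- The representation attached to operators satisfying the `Q₈` relations. -/
abbrev QX.rep {x y : V →ₗ[k] V} (h : QX x y) : Rep.{0} k G :=
  Rep.of (((qlift (R := Module.End k V) (1 + x) (1 + y) h.rA h.rB h.rBA).comp e.toMonoidHom :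
      Representation k G V))

lemma QX.rep_X {x y : V →ₗ[k] V} (h : QX x y) : X e (h.rep e) = x := by
  have : (h.rep e).ρ (th e) = 1 + x := by
    change qlift (R := Module.End k V) (1 + x) (1 + y) h.rA h.rB h.rBA (e (e.symm (.a 1))) = _
    rw [e.apply_symm_apply]
    change (1 + x : Module.End k V) ^ 1 = _
    rw [pow_one]
  unfold X
  rw [this]
  exact add_sub_cancel_left _ _

lemma QX.rep_Y {x y : V →ₗ[k] V} (h : QX x y) : Y e (h.rep e) = y := by
  have : (h.rep e).ρ (ta e) = 1 + y := by
    change qlift (R := Module.End k V) (1 + x) (1 + y) h.rA h.rB h.rBA (e (e.symm (.xa 0))) = _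
    rw [e.apply_symm_apply]
    change (1 + y : Module.End k V) * (1 + x) ^ 0 = _
    rw [pow_zero, mul_one]
  unfold Y
  rw [this]
  exact add_sub_cancel_left _ _

/-- `x` on the five-dimensional module -/
def x5 : (Fin 5 → k) →ₗ[k] (Fin 5 → k) where
  toFun v := ![0, v 0, v 1, v 2, 0]
  map_add' u v := by ext i; fin_cases i <;> simp
  map_smul' a v := by ext i; fin_cases i <;> simp

/-- `y` on the five-dimensional module -/
def y5 (o : k) : (Fin 5 → k) →ₗ[k] (Fin 5 → k) where
  toFun v := ![0, o * v 0, (o + 1) * v 1, (o + 1) * v 1 + o * v 2 + v 4, v 0]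
  map_add' u v := by ext i; fin_cases i <;> simp <;> ring
  map_smul' a v := by ext i; fin_cases i <;> simp <;> ring

lemma x5_apply (v : Fin 5 → k) : x5 v = ![0, v 0, v 1, v 2, 0] := rfl
lemma y5_apply (o : k) (v : Fin 5 → k) :
    y5 o v = ![0, o * v 0, (o + 1) * v 1, (o + 1) * v 1 + o * v 2 + v 4, v 0] := rfl

lemma shape5 {o : k} (ho : o * o = o + 1) :
    Shape5 (x5 (k := k)) (y5 o) o ![1, 0, 0, 0, 0] ![0, 0, 0, 0, 1] where
  hyy v := by
    ext i; fin_cases i <;> simp [x5_apply, y5_apply, Matrix.vecHead, Matrix.vecTail] <;> grind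
  hyx v := by
    ext i; fin_cases i <;> simp [x5_apply, y5_apply, Matrix.vecHead, Matrix.vecTail] <;> grind
  h4 v := by
    ext i; fin_cases i <;> simp [x5_apply, y5_apply]
  yc := by
    ext i; fin_cases i <;> simp [x5_apply, y5_apply]
  xw := by
    ext i; fin_cases i <;> simp [x5_apply, y5_apply]
  yw := by
    ext i; fin_cases i <;> simp [x5_apply, y5_apply]
  ne h := by
    have := congrFun h 3
    simp [x5_apply] at this
  wI u h := by
    have := congrFun h 4
    simp [x5_apply] at this
  span v := by
    refine ⟨v 0, v 1, v 2, v 3, v 4, ?_⟩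
    ext i; fin_cases i <;> simp [x5_apply]

/-- the five-dimensional module -/
noncomputable abbrev L5 {o : k} (ho : o * o = o + 1) : Rep.{0} k G := (shape5 ho).toQX.rep e

lemma L5_X {o : k} (ho : o * o = o + 1) : X e (L5 e ho) = x5 := QX.rep_X e _
lemma L5_Y {o : k} (ho : o * o = o + 1) : Y e (L5 e ho) = y5 o := QX.rep_Y e _

lemma Shape5.NZ {M : Rep.{0} k G} {o : k} {c w : M.V} (h : Shape5 (X e M) (Y e M) o c w) : NZ e M := by
  intro v
  obtain ⟨a0, a1, a2, a3, μ, rfl⟩ := h.span v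
  simp only [map_add, map_smul, h.yc, h.yw, h.hyx, h.h4, h.xw, map_zero, smul_zero, add_zero]

lemma Shape5.ty {M : Rep.{0} k G} {o : k} {c w : M.V} (h : Shape5 (X e M) (Y e M) o c w) : tyK e M := by
  refine ⟨w, ⟨by rw [h.xw, map_zero], h.wI, fun v hv => ?_⟩, h.xw⟩
  obtain ⟨a0, a1, a2, a3, μ, rfl⟩ := h.span v
  simp only [map_add, map_smul, h.yc, h.yw, h.hyx, h.h4, h.xw, map_zero, smul_zero, add_zero] at hv
  have e1 := congrArg (X e M) hv
  simp only [map_add, map_smul, h.h4, smul_zero, add_zero, map_zero] at e1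
  have h0 : a0 = 0 := (smul_eq_zero.1 e1).resolve_right h.ne
  subst h0
  rw [zero_smul, zero_add] at hv
  have h1 : a1 = 0 := (smul_eq_zero.1 hv).resolve_right h.ne
  subst h1
  refine ⟨a2 • c + a3 • X e M c, μ, ?_⟩
  simp only [map_add, map_smul]
  module

lemma Shape5.finrank {M : Rep.{0} k G} {o : k} {c w : M.V} (h : Shape5 (X e M) (Y e M) o c w) :
    Module.finrank k M.V = 5 := by
  obtain ⟨B, -⟩ := h.basis
  simpa using Module.finrank_eq_card_basis B

lemma Shape9.finrank {M : Rep.{0} k G} {o : k} {c1 c2 w : M.V} (h : Shape9 (X e M) (Y e M) o c1 c2 w) :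
    Module.finrank k M.V = 9 := by
  obtain ⟨B, -⟩ := h.basis
  simpa using Module.finrank_eq_card_basis B

lemma L5_shape {o : k} (ho : o * o = o + 1) :
    ∃ c w, Shape5 (X e (L5 e ho)) (Y e (L5 e ho)) o c w := by
  rw [L5_X, L5_Y]
  exact ⟨_, _, shape5 ho⟩

/-- invariant form -/
def β5 : (Fin 5 → k) →ₗ[k] (Fin 5 → k) →ₗ[k] k :=
  LinearMap.mk₂ k (fun u v => u 0 * (v 1 + v 3) + u 1 * (v 1 + v 2) + u 2 * v 1 + u 3 * v 0 + u 4 * v 4)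
    (by intros; simp; ring) (by intros; simp; ring) (by intros; simp; ring) (by intros; simp; ring)

lemma β5_apply (u v : Fin 5 → k) : β5 u v =
  u 0 * (v 1 + v 3) + u 1 * (v 1 + v 2) + u 2 * v 1 + u 3 * v 0 + u 4 * v 4 := rfl

lemma β5_inj : Function.Injective (β5 (k := k)) := by
  rw [injective_iff_map_eq_zero]
  intro u hu
  have h := fun v => congrArg (fun q => q v) hu
  simp only [β5_apply, LinearMap.zero_apply] at h
  have h0 := h ![1, 0, 0, 0, 0]
  have h1 := h ![0, 1, 0, 0, 0]
  have h2 := h ![0, 0, 1, 0, 0]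
  have h3 := h ![0, 0, 0, 1, 0]
  have h4 := h ![0, 0, 0, 0, 1]
  simp at h0 h1 h2 h3 h4
  ext i
  fin_cases i <;> simp_all

lemma β5_inv {o : k} (ho : o * o = o + 1) (g : G) (u v : Fin 5 → k) :
    β5 ((L5 e ho).ρ g u : Fin 5 → k) ((L5 e ho).ρ g v : Fin 5 → k) = β5 u v := by
  have hX : ∀ u : Fin 5 → k, ((L5 e ho).ρ (th e) u : Fin 5 → k) = x5 u + u := by
    intro u
    rw [← L5_X e ho, X_apply]; exact (sub_add_cancel _ _).symm
  have hY : ∀ u : Fin 5 → k, ((L5 e ho).ρ (ta e) u : Fin 5 → k) = y5 o u + u := by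
    intro u
    rw [← L5_Y e ho, Y_apply]; exact (sub_add_cancel _ _).symm
  have t1 : ∀ u v : Fin 5 → k, β5 (x5 u + u) (x5 v + v) = β5 u v := by
    intro u v
    simp [β5_apply, x5_apply, Matrix.vecHead, Matrix.vecTail]
    grind
  have t2 : ∀ u v : Fin 5 → k, β5 (y5 o u + u) (y5 o v + v) = β5 u v := by
    intro u v
    simp [β5_apply, y5_apply, Matrix.vecHead, Matrix.vecTail]
    grind
  obtain ⟨i, j, rfl⟩ := gen e g
  rw [map_mul, Module.End.mul_apply, Module.End.mul_apply]
  have s1 : ∀ (n : ℕ) (u v : Fin 5 → k),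
      β5 ((L5 e ho).ρ (th e ^ n) u : Fin 5 → k) ((L5 e ho).ρ (th e ^ n) v : Fin 5 → k) = β5 u v := by
    intro n
    induction n with
    | zero => intro u v; rw [pow_zero, map_one]; rfl
    | succ n ih =>
      intro u v
      rw [pow_succ, map_mul, Module.End.mul_apply, Module.End.mul_apply]
      exact (ih _ _).trans (by rw [hX, hX]; exact t1 u v)
  have s2 : ∀ (n : ℕ) (u v : Fin 5 → k),
      β5 ((L5 e ho).ρ (ta e ^ n) u : Fin 5 → k) ((L5 e ho).ρ (ta e ^ n) v : Fin 5 → k) = β5 u v := by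
    intro n
    induction n with
    | zero => intro u v; rw [pow_zero, map_one]; rfl
    | succ n ih =>
      intro u v
      rw [pow_succ, map_mul, Module.End.mul_apply, Module.End.mul_apply]
      exact (ih _ _).trans (by rw [hY, hY]; exact t2 u v)
  exact (s1 i _ _).trans (s2 j u v)

lemma tensor_self {L : Rep.{0} k G} [FiniteDimensional k L.V] (β : L.V →ₗ[k] L.V →ₗ[k] k)
    (hi : Function.Injective β) (hβ : ∀ g u v, β (L.ρ g u) (L.ρ g v) = β u v) :
    Nonempty (L ⊗ L ≅ En L) := by
  let b : L.V ≃ₗ[k] Module.Dual k L.V := LinearEquiv.ofInjectiveOfFinrankEq β hi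
    (Subspace.dual_finrank_eq (K := k) (V := L.V)).symm
  let E : TensorProduct k L.V L.V ≃ₗ[k] (L.V →ₗ[k] L.V) :=
    (TensorProduct.congr b (LinearEquiv.refl k L.V)).trans (dualTensorHomEquiv k L.V L.V)
  have hE : ∀ u v t, E (u ⊗ₜ v) t = β u t • v := by
    intro u v t
    simp [E, b]
    rfl
  have h : ∀ g (t : (L ⊗ L).V), E ((L ⊗ L).ρ g t) = (En L).ρ g (E t : L.V →ₗ[k] L.V) := by
    intro g t
    induction t using TensorProduct.induction_on with
    | zero => simp only [map_zero]
    | add a b ha hb => simp only [map_add, ha, hb]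
    | tmul u v =>
      apply LinearMap.ext; intro t
      change E (L.ρ g u ⊗ₜ L.ρ g v) t = L.ρ g (E (u ⊗ₜ v) (L.ρ g⁻¹ t))
      rw [hE, hE, map_smul]
      congr 1
      rw [← hβ g u, ← Module.End.mul_apply, ← map_mul]
      simp
  refine ⟨⟨mkHom (M := L ⊗ L) (N := En L) E.toLinearMap h,
    mkHom (M := En L) (N := L ⊗ L) E.symm.toLinearMap fun g v => ?_, lin_ext fun v => ?_,
    lin_ext fun v => ?_⟩⟩
  · apply E.injective
    have := h g (E.symm v)
    simp only [LinearEquiv.coe_coe, LinearEquiv.apply_symm_apply] at this ⊢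
    exact this.symm
  · exact E.symm_apply_apply v
  · exact E.apply_symm_apply v

lemma L5_fd {o : k} (ho : o * o = o + 1) : FiniteDimensional k (L5 e ho).V :=
  inferInstanceAs (FiniteDimensional k (Fin 5 → k))

lemma L5_sq {o : k} (ho : o * o = o + 1) : SEq (L5 e ho ⊗ L5 e ho) (Rep.trivial k G k) := by
  obtain ⟨c, w, hs⟩ := L5_shape e ho
  have := L5_fd e ho
  obtain ⟨i⟩ := tensor_self (L := L5 e ho) β5 β5_inj (fun g u v => β5_inv e ho g u v)
  obtain ⟨-, P, hP, ⟨j⟩⟩ := endotrivial_of_E1 (e := e) ho this hs.ty.E1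
  rw [projective_iff] at hP
  exact (SEq.of_iso i).trans ((SEq.of_iso j).trans (SEq.biprod_proj hP))

end build
end QE

namespace QE
section syz2
variable {k G : Type} [Field k] [CharP k 2] [Group G] [Fintype G] (e : G ≃* QuaternionGroup 2)

variable (k G) in
/-- the augmentation ideal -/
abbrev JJ : Rep.{0} k G := KerRep (sumInd (Rep.trivial k G k))

variable (k G) in
lemma syzJ : Syz (JJ k G) (Rep.trivial k G k) :=
  Syz.ker (Ind_FP _) _ (sumInd_surj _)

lemma cardG (e : G ≃* QuaternionGroup 2) : Fintype.card G = 8 := by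
  rw [Fintype.card_congr e.toEquiv]; rfl

/-- the free module of rank two -/
abbrev FF (k G : Type) [Field k] [Group G] [Fintype G] : Rep.{0} k G :=
  Ind (Rep.trivial k G (k × k))

/-- the second differential, as a linear map -/
def dLin : (G → k × k) →ₗ[k] (G → k) where
  toFun F h := (F (h * (th e)⁻¹)).1 - (F h).1 + ((F (h * (ta e)⁻¹)).2 - (F h).2)
  map_add' u v := by funext h; simp; ring
  map_smul' a v := by funext h; simp; ring

lemma dLin_apply (F : G → k × k) (h : G) :
    dLin e F h = (F (h * (th e)⁻¹)).1 - (F h).1 + ((F (h * (ta e)⁻¹)).2 - (F h).2) := rfl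

lemma dLin_sum (F : G → k × k) (ψ : G → k) : ∑ h, ψ h * dLin e F h =
    ∑ h, ((ψ (h * th e) - ψ h) * (F h).1 + (ψ (h * ta e) - ψ h) * (F h).2) := by
  have h1 : ∑ h, ψ h * (F (h * (th e)⁻¹)).1 = ∑ h, ψ (h * th e) * (F h).1 :=
    Fintype.sum_equiv (Equiv.mulRight (th e)⁻¹) _ _ fun h => by simp
  have h2 : ∑ h, ψ h * (F (h * (ta e)⁻¹)).2 = ∑ h, ψ (h * ta e) * (F h).2 :=
    Fintype.sum_equiv (Equiv.mulRight (ta e)⁻¹) _ _ fun h => by simp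
  simp only [dLin_apply, mul_add, mul_sub, sub_mul, Finset.sum_add_distrib, Finset.sum_sub_distrib, h1, h2]

/-- the second differential -/
def dd : FF k G ⟶ JJ k G :=
  mkHom (M := FF k G) (N := JJ k G)
    (LinearMap.codRestrict (LinearMap.ker (lin (sumInd (Rep.trivial k G k)))) (dLin e) (by
      intro F
      rw [LinearMap.mem_ker, sumInd_apply]
      have := dLin_sum e F (fun _ => 1)
      simpa using this))
    (by
      intro g F
      apply Subtype.ext
      funext h
      change dLin e (IndRho (Rep.trivial k G (k × k)) g F) h = dLin e F (g⁻¹ * h)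
      simp only [dLin_apply, Ind_apply, mul_assoc]
      rfl)

lemma dd_val (F : G → k × k) : (lin (kerι (sumInd (Rep.trivial k G k))) (lin (dd e) F) : G → k) = dLin e F := rfl

open Classical in
lemma dd_range (g : G) : ∀ h : G, (Pi.single (h * g) 1 - Pi.single h 1 : G → k) ∈ LinearMap.range (dLin (k := k) e) := by
  have hθ : ∀ h : G, (Pi.single (h * th e) 1 - Pi.single h 1 : G → k) ∈ LinearMap.range (dLin (k := k) e) := by
    intro h
    refine ⟨Pi.single h (1, 0), ?_⟩
    funext t
    rw [dLin_apply]
    simp only [Pi.single_apply, Pi.sub_apply, mul_inv_eq_iff_eq_mul]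
    split_ifs <;> simp
  have hτ : ∀ h : G, (Pi.single (h * ta e) 1 - Pi.single h 1 : G → k) ∈ LinearMap.range (dLin (k := k) e) := by
    intro h
    refine ⟨Pi.single h (0, 1), ?_⟩
    funext t
    rw [dLin_apply]
    simp only [Pi.single_apply, Pi.sub_apply, mul_inv_eq_iff_eq_mul]
    split_ifs <;> simp
  have hm : ∀ a b : G, (∀ h : G, (Pi.single (h * a) 1 - Pi.single h 1 : G → k) ∈ LinearMap.range (dLin (k := k) e)) →
      (∀ h : G, (Pi.single (h * b) 1 - Pi.single h 1 : G → k) ∈ LinearMap.range (dLin (k := k) e)) →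
      (∀ h : G, (Pi.single (h * (a * b)) 1 - Pi.single h 1 : G → k) ∈ LinearMap.range (dLin (k := k) e)) := by
    intro a b ha hb h
    have := Submodule.add_mem _ (hb (h * a)) (ha h)
    rwa [sub_add_sub_cancel, mul_assoc] at this
  have hp : ∀ a : G, (∀ h : G, (Pi.single (h * a) 1 - Pi.single h 1 : G → k) ∈ LinearMap.range (dLin (k := k) e)) →
      ∀ n : ℕ, (∀ h : G, (Pi.single (h * a ^ n) 1 - Pi.single h 1 : G → k) ∈ LinearMap.range (dLin (k := k) e)) := by
    intro a ha n
    induction n with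
    | zero => intro h; simp
    | succ n ih => rw [pow_succ]; exact hm _ _ ih ha
  obtain ⟨i, j, rfl⟩ := gen e g
  exact hm _ _ (hp _ hθ i) (hp _ hτ j)

open Classical in
lemma dd_surj : Function.Surjective (lin (dd (k := k) e)) := by
  rintro ⟨F, hF⟩
  obtain ⟨F', hF'⟩ : ∃ F' : G → k, F' = F := ⟨F, rfl⟩
  have h0 : ∑ h, F' h = 0 := by
    rw [LinearMap.mem_ker, sumInd_apply] at hF
    rw [hF']; exact hF
  have h1 : F' = ∑ g : G, F' g • (Pi.single (1 * g) 1 - Pi.single 1 1 : G → k) := by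
    simp only [smul_sub, Finset.sum_sub_distrib, ← Finset.sum_smul, h0, zero_smul, sub_zero, one_mul]
    funext t
    simp [Finset.sum_apply, Pi.single_apply]
  have h2 : F' ∈ LinearMap.range (dLin (k := k) e) := by
    rw [h1]
    exact Submodule.sum_mem _ fun g _ => Submodule.smul_mem _ _ (dd_range e g 1)
  obtain ⟨u, hu⟩ := h2
  refine ⟨u, Subtype.ext ?_⟩
  exact (hu.trans hF' : dLin e u = F)

/-- the second syzygy -/
abbrev RR : Rep.{0} k G := KerRep (dd (k := k) e)

lemma syzR : Syz (RR (k := k) e) (JJ k G) := Syz.ker (Ind_FP _) _ (dd_surj e)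

lemma finrank_J (e : G ≃* QuaternionGroup 2) : Module.finrank k (JJ k G).V = 7 := by
  have h1 := LinearMap.finrank_range_add_finrank_ker (lin (sumInd (Rep.trivial k G k)))
  rw [LinearMap.range_eq_top.2 (sumInd_surj _), finrank_top] at h1
  have h2 : Module.finrank k (Ind (Rep.trivial k G k)).V = 8 := by
    change Module.finrank k (G → k) = 8
    rw [Module.finrank_pi, cardG e]
  have h3 : Module.finrank k (Rep.trivial k G k).V = 1 := Module.finrank_self k
  rw [h2, h3] at h1
  change Module.finrank k (LinearMap.ker (lin (sumInd (Rep.trivial k G k)))) = 7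
  omega

lemma finrank_R : Module.finrank k (RR (k := k) e).V = 9 := by
  have hfd : FiniteDimensional k (FF k G).V := inferInstanceAs (FiniteDimensional k (G → k × k))
  have h1 := LinearMap.finrank_range_add_finrank_ker (lin (dd (k := k) e))
  rw [LinearMap.range_eq_top.2 (dd_surj e), finrank_top, finrank_J e] at h1
  have h2 : Module.finrank k (FF k G).V = 16 := by
    change Module.finrank k (G → k × k) = 16
    rw [Module.finrank_pi_fintype]
    simp [cardG e]
  rw [h2] at h1
  change Module.finrank k (LinearMap.ker (lin (dd (k := k) e))) = 9
  omega

lemma R_fd : FiniteDimensional k (RR (k := k) e).V := by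
  have hfd : FiniteDimensional k (FF k G).V := inferInstanceAs (FiniteDimensional k (G → k × k))
  infer_instance

/-- parity in the first direction -/
def par1 : QuaternionGroup 2 → ZMod 2
  | .a i => ((ZMod.val (n := 4) i : ℕ) : ZMod 2)
  | .xa i => ((ZMod.val (n := 4) i : ℕ) : ZMod 2)
/-- parity in the second direction -/
def par2 : QuaternionGroup 2 → ZMod 2
  | .a _ => 0
  | .xa _ => 1

lemma par1_spec : ∀ q : QuaternionGroup 2, par1 (q * .a 1) = par1 q + 1 ∧ par1 (q * .xa 0) = par1 q := by
  decide
lemma par2_spec : ∀ q : QuaternionGroup 2, par2 (q * .a 1) = par2 q ∧ par2 (q * .xa 0) = par2 q + 1 := by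
  decide

lemma R_NZ : NZ e (RR (k := k) e) := by
  intro v
  rw [← norm_eq]
  apply kerι_inj
  rw [map_sum, map_zero]
  obtain ⟨F, hF⟩ : ∃ F : G → k × k, F = lin (kerι (dd (k := k) e)) v := ⟨_, rfl⟩
  have hd : dLin e F = 0 := by
    have h1 : lin (dd (k := k) e) (lin (kerι (dd (k := k) e)) v) = 0 := v.2
    rw [← hF] at h1
    rw [← dd_val, h1, map_zero]
  let c := ZMod.castHom (dvd_refl 2) k
  have s1 := dLin_sum e F (fun h => c (par1 (e h)))
  have s2 := dLin_sum e F (fun h => c (par2 (e h)))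
  simp only [th, ta, map_mul, e.apply_symm_apply, (par1_spec _).1, (par1_spec _).2, (par2_spec _).1,
    (par2_spec _).2, map_add, map_one, hd, add_sub_cancel_left, sub_self, zero_mul, one_mul, add_zero,
    zero_add, Pi.zero_apply, mul_zero, Finset.sum_const_zero] at s1 s2
  have hs : ∑ h, F h = 0 := by
    apply Prod.ext
    · rw [Prod.fst_sum, ← s1]; rfl
    · rw [Prod.snd_sum, ← s2]; rfl
  have hg : ∀ g : G, lin (kerι (dd (k := k) e)) ((RR (k := k) e).ρ g v) = (FF k G).ρ g F := fun g => by
    rw [hF]; exact lin_eqv (kerι (dd (k := k) e)) g v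
  refine (Finset.sum_congr rfl fun g _ => hg g).trans ?_
  funext h
  refine (Finset.sum_apply (M := fun _ : G => k × k) h Finset.univ _).trans ?_
  change ∑ g : G, F (g⁻¹ * h) = 0
  rw [← hs]
  exact Fintype.sum_equiv ((Equiv.inv G).trans (Equiv.mulRight h)) _ _ fun g => by simp

lemma R_ty : tyK e (RR (k := k) e) :=
  (syzR e).tyO_tyK ((syzJ k G).tyK_tyO (tyK_triv e))

end syz2
end QE

namespace QE
section final
variable {k G : Type} [Field k] [CharP k 2] [Group G] [Fintype G] (e : G ≃* QuaternionGroup 2)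
  {o : k} (ho : o * o = o + 1)

lemma seq_of_XY {M N : Rep.{0} k G}
    (h : ∃ f : M.V ≃ₗ[k] N.V, (∀ v, f (X e M v) = X e N (f v)) ∧ ∀ v, f (Y e M v) = Y e N (f v)) :
    SEq M N := by
  obtain ⟨f, h1, h2⟩ := h
  obtain ⟨i⟩ := iso_of_XY e f h1 h2
  exact SEq.of_iso i


lemma cls {o : k} (ho : o * o = o + 1) {M : Rep.{0} k G} (hN : NZ e M) (hK : tyK e M) :
    (Module.finrank k M.V = 1 ∧ SEq M (Rep.trivial k G k)) ∨
    (∃ c w, Shape5 (X e M) (Y e M) o c w) ∨ (∃ c w, Shape5 (X e M) (Y e M) (o + 1) c w) ∨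
      ∃ c1 c2 w, Shape9 (X e M) (Y e M) o c1 c2 w := by
  obtain ⟨w, hw, xw⟩ := hK
  rcases classify (qx e M) hN ho xw hw.ni hw.K with h | h
  · left
    have w0 : w ≠ 0 := fun h0 => hw.ni 0 (by simp [h0])
    have f1 : Module.finrank k M.V = 1 := finrank_eq_one w w0 fun v => (h v).imp fun _ => Eq.symm
    refine ⟨f1, ?_⟩
    have yw : Y e M w = 0 := by
      obtain ⟨μ, hμ⟩ := h (Y e M w)
      have h1 := (qx e M).hyy w
      rw [hμ, map_smul, hμ, xw, map_zero, smul_smul] at h1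
      have : μ * μ = 0 := (smul_eq_zero.1 h1).resolve_right w0
      rw [hμ, mul_self_eq_zero.1 this, zero_smul]
    refine (seq_of_XY e (M := Rep.trivial k G k) (N := M)
      ⟨LinearEquiv.ofBijective (LinearMap.toSpanSingleton k M.V w) ⟨?_, ?_⟩, ?_, ?_⟩).symm
    · exact LinearMap.ker_eq_bot.1 (LinearMap.ker_toSpanSingleton k w0)
    · exact fun v => (h v).imp fun _ => Eq.symm
    · intro v
      have : X e (Rep.trivial k G k) v = 0 := sub_self v
      rw [this, map_zero]
      change 0 = X e M (v • w)
      rw [map_smul, xw, smul_zero]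
    · intro v
      have : Y e (Rep.trivial k G k) v = 0 := sub_self v
      rw [this, map_zero]
      change 0 = Y e M (v • w)
      rw [map_smul, yw, smul_zero]
  · exact Or.inr h


lemma R_shape {o : k} (ho : o * o = o + 1) : ∃ c1 c2 w, Shape9 (X e (RR (k := k) e)) (Y e (RR (k := k) e)) o c1 c2 w := by
  have h9 := finrank_R (k := k) e
  rcases cls e ho (R_NZ (k := k) e) (R_ty e) with ⟨h, -⟩ | ⟨c, w, h⟩ | ⟨c, w, h⟩ | h
  · omega
  · have := h.finrank; omega
  · have := h.finrank; omega
  · exact h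

lemma cls' (N : Rep.{0} k G) (hfd : FiniteDimensional k N.V) (hK : tyK e N) :
    SEq N (Rep.trivial k G k) ∨ SEq N (L5 e ho) ∨ SEq N (RR (k := k) e) ∨
      ∃ N', SEq N N' ∧ ∃ c w, Shape5 (X e N') (Y e N') (o + 1) c w := by
  obtain ⟨N', hfd', hs, hN⟩ := strip e _ N hfd rfl
  rcases cls e ho hN (hK.seq hs) with ⟨-, h⟩ | ⟨c, w, h⟩ | h | ⟨c1, c2, w, h⟩
  · exact Or.inl (hs.trans h)
  · obtain ⟨c', w', h'⟩ := L5_shape e ho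
    exact Or.inr (Or.inl (hs.trans (seq_of_XY e (h.iso h'))))
  · exact Or.inr (Or.inr (Or.inr ⟨N', hs, h⟩))
  · obtain ⟨c1', c2', w', h'⟩ := R_shape e ho
    exact Or.inr (Or.inr (Or.inl (hs.trans (seq_of_XY e (h.iso h')))))

lemma L5_NZ : NZ e (L5 e ho) := by
  obtain ⟨c', w', h'⟩ := L5_shape e ho
  exact h'.NZ

lemma L5_ty : tyK e (L5 e ho) := by
  obtain ⟨c', w', h'⟩ := L5_shape e ho
  exact h'.ty

lemma L5_finrank : Module.finrank k (L5 e ho).V = 5 := by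
  obtain ⟨c', w', h'⟩ := L5_shape e ho
  exact h'.finrank

lemma L_ne_k (h : SEq (L5 e ho) (Rep.trivial k G k)) : False := by
  have : FiniteDimensional k (Rep.trivial k G k).V := inferInstanceAs (FiniteDimensional k k)
  have h1 := h.finrank_le (L5_NZ e ho)
  rw [L5_finrank] at h1
  have h3 : Module.finrank k (Rep.trivial k G k).V = 1 := Module.finrank_self k
  omega

lemma R_ne_k (h : SEq (RR (k := k) e) (Rep.trivial k G k)) : False := by
  have : FiniteDimensional k (Rep.trivial k G k).V := inferInstanceAs (FiniteDimensional k k)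
  have h1 := h.finrank_le (R_NZ e)
  rw [finrank_R] at h1
  have h3 : Module.finrank k (Rep.trivial k G k).V = 1 := Module.finrank_self k
  omega

lemma R_ne_L (h : SEq (RR (k := k) e) (L5 e ho)) : False := by
  have := L5_fd e ho
  have h1 := h.finrank_le (R_NZ e)
  rw [finrank_R, L5_finrank] at h1
  omega

lemma unit_tensor (L : Rep.{0} k G) : SEq (Rep.trivial k G k ⊗ L) L :=
  SEq.of_iso (λ_ L)

/-- cancel the self-inverse module -/
lemma cancelL {A B : Rep.{0} k G} (h : SEq (A ⊗ L5 e ho) B) : SEq A (B ⊗ L5 e ho) := by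
  have h1 := h.whisker (L5 e ho)
  refine SEq.trans ?_ h1
  have h2 : SEq (A ⊗ (L5 e ho ⊗ L5 e ho)) A := by
    refine (SEq.of_iso (β_ _ _)).trans ?_
    exact ((L5_sq e ho).whisker A).trans (unit_tensor A)
  exact h2.symm.trans (SEq.of_iso (α_ _ _ _).symm)

lemma RL_fd : FiniteDimensional k (RR (k := k) e ⊗ L5 e ho : Rep.{0} k G).V := by
  have := L5_fd e ho
  have := R_fd (k := k) e
  exact inferInstanceAs (FiniteDimensional k (TensorProduct k (RR (k := k) e).V (L5 e ho).V))

lemma RL_ty : tyK e (RR (k := k) e ⊗ L5 e ho) :=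
  ((syzR e).whisker _).tyO_tyK (((syzJ k G).whisker _).tyK_tyO
    ((L5_ty e ho).seq (unit_tensor (L5 e ho)).symm))

lemma RL_shape : ∃ N', SEq (RR (k := k) e ⊗ L5 e ho) N' ∧
    ∃ c w, Shape5 (X e N') (Y e N') (o + 1) c w := by
  rcases cls' e ho _ (RL_fd e ho) (RL_ty e ho) with h | h | h | h
  · exact (R_ne_L e ho ((cancelL e ho h).trans (unit_tensor _))).elim
  · exact (R_ne_k e ((cancelL e ho h).trans (L5_sq e ho))).elim
  · have h1 := ((syzR e).whisker (L5 e ho)).seq_up (syzR (k := k) e) h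
    have h2 := ((syzJ k G).whisker (L5 e ho)).seq_up (syzJ k G) h1
    exact (L_ne_k e ho ((unit_tensor _).symm.trans h2)).elim
  · exact h

theorem clsK (N : Rep.{0} k G) (hfd : FiniteDimensional k N.V) (hK : tyK e N) :
    SEq N (Rep.trivial k G k) ∨ SEq N (Rep.trivial k G k ⊗ L5 e ho) ∨ SEq N (RR (k := k) e) ∨
      SEq N (RR (k := k) e ⊗ L5 e ho) := by
  rcases cls' e ho N hfd hK with h | h | h | ⟨N', h, c, w, hs⟩
  · exact Or.inl h
  · exact Or.inr (Or.inl (h.trans (unit_tensor _).symm))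
  · exact Or.inr (Or.inr (Or.inl h))
  · obtain ⟨T, h', c', w', hs'⟩ := RL_shape e ho
    exact Or.inr (Or.inr (Or.inr (h.trans ((seq_of_XY e (hs.iso hs')).trans h'.symm))))

/-- every finite-dimensional module is a syzygy -/
lemma cosyz (N : Rep.{0} k G) (hfd : FiniteDimensional k N.V) :
    ∃ C : Rep.{0} k G, FiniteDimensional k C.V ∧ Syz N C := by
  have hI : FiniteDimensional k (Ind N).V := inferInstanceAs (FiniteDimensional k (G → N.V))
  let W := LinearMap.range (lin (toInd N))
  have hW : ∀ g : G, W ≤ W.comap ((Ind N).ρ g) := by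
    rintro g _ ⟨v, rfl⟩
    exact ⟨N.ρ g v, lin_eqv (toInd N) g v⟩
  let ρ' : Representation k G ((Ind N).V ⧸ W) :=
    { toFun := fun g => W.mapQ W ((Ind N).ρ g) (hW g)
      map_one' := by
        apply Submodule.linearMap_qext
        ext v
        simp
      map_mul' := fun g h => by
        apply Submodule.linearMap_qext
        ext v
        simp }
  refine ⟨Rep.of ρ', inferInstanceAs (FiniteDimensional k ((Ind N).V ⧸ W)), ?_⟩
  refine Syz.mk' (Ind_FP N) (toInd N) (mkHom (N := Rep.of ρ') W.mkQ fun g v => rfl) (toInd_inj N) ?_ ?_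
  · intro v
    change W.mkQ v = 0 ↔ v ∈ Set.range (lin (toInd N))
    rw [Submodule.mkQ_apply, Submodule.Quotient.mk_eq_zero]
    rfl
  · exact W.mkQ_surjective

lemma cls_all (N : Rep.{0} k G) (hN : IsEndotrivial N) {M0 M1 M2 M3 : Rep.{0} k G}
    (h0 : SEq M0 (Rep.trivial k G k)) (s0 : Syz M1 M0) (s1 : Syz M2 M1) (s2 : Syz M3 M2) :
    (SEq N M0 ∨ SEq N (M0 ⊗ L5 e ho)) ∨ (SEq N M1 ∨ SEq N (M1 ⊗ L5 e ho)) ∨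
    (SEq N M2 ∨ SEq N (M2 ⊗ L5 e ho)) ∨ (SEq N M3 ∨ SEq N (M3 ⊗ L5 e ho)) := by
  have h1 : SEq M1 (JJ k G) := s0.seq_down (syzJ k G) h0
  have h2 : SEq M2 (RR (k := k) e) := s1.seq_down (syzR e) h1
  have key : ∀ C : Rep.{0} k G, FiniteDimensional k C.V → tyK e C →
      (SEq C M0 ∨ SEq C (M0 ⊗ L5 e ho)) ∨ (SEq C M2 ∨ SEq C (M2 ⊗ L5 e ho)) := by
    intro C hC hK
    rcases clsK e ho C hC hK with h | h | h | h
    · exact Or.inl (Or.inl (h.trans h0.symm))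
    · exact Or.inl (Or.inr (h.trans (h0.whisker _).symm))
    · exact Or.inr (Or.inl (h.trans h2.symm))
    · exact Or.inr (Or.inr (h.trans (h2.whisker _).symm))
  rcases (E1_of_endotrivial (e := e) hN).ty with hK | hO
  · rcases key N hN.1 hK with h | h
    · exact Or.inl h
    · exact Or.inr (Or.inr (Or.inl h))
  · obtain ⟨C, hC, hs⟩ := cosyz N hN.1
    rcases key C hC (hs.tyO_up hO) with (h | h) | (h | h)
    · exact Or.inr (Or.inl (Or.inl (hs.seq_down s0 h)))
    · exact Or.inr (Or.inl (Or.inr (hs.seq_down (s0.whisker _) h)))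
    · exact Or.inr (Or.inr (Or.inr (Or.inl (hs.seq_down s2 h))))
    · exact Or.inr (Or.inr (Or.inr (Or.inr (hs.seq_down (s2.whisker _) h))))

end final
end QE

/-- Let `k` be a field of characteristic `2` containing a primitive cube root of unity and
`G = Q_8` (`QuaternionGroup 2`). If `M 0` is the trivial module and each `M (i+1)` is a
syzygy of `M i`, then the `M i` are pairwise non-stably-isomorphic endotrivial modules, and
there is a finite-dimensional endotrivial module `L` with `L ⊗ L` stably trivial, `L` not
stably isomorphic to any `M i`, such that every endotrivial module is stably isomorphic to
some `M i` or some `M i ⊗ L`; hence `T(Q_8) = Pic(StMod(kQ_8)) ≅ C_4 ⊕ C_2`. -/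
theorem endotrivial_group_of_quaternion_with_cube_root
    (k : Type) [Field k] [CharP k 2] (hk : ∃ ω : k, ω ^ 3 = 1 ∧ ω ≠ 1)
    (G : Type) [Group G] (e : G ≃* QuaternionGroup 2)
    (M : Fin 4 → Rep k G)
    (hM0 : Nonempty (M 0 ≅ Rep.trivial k G k))
    (hseq : ∀ i : Fin 3, ∃ (P : Rep k G) (_ : Projective P) (_ : FiniteDimensional k P.V)
      (f : M i.succ ⟶ P) (g : P ⟶ M i.castSucc) (w : f ≫ g = 0),
      (ShortComplex.mk f g w).ShortExact) :
    (∀ i : Fin 4, IsEndotrivial (M i)) ∧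
      (∀ i j : Fin 4, i ≠ j → ¬ IsStablyIso (M i) (M j)) ∧
      ∃ L : Rep k G, IsEndotrivial L ∧
        IsStablyIso (L ⊗ L) (Rep.trivial k G k) ∧
        (∀ i : Fin 4, ¬ IsStablyIso L (M i)) ∧
        (∀ N : Rep k G, IsEndotrivial N →
          ∃ i : Fin 4, IsStablyIso N (M i) ∨ IsStablyIso N (M i ⊗ L)) := by
  classical
  haveI : Fintype G := Fintype.ofEquiv _ e.symm.toEquiv
  obtain ⟨o, ho3, ho1⟩ := hk
  have h2 : (2 : k) = 0 := CharP.cast_eq_zero k 2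
  have ho : o * o = o + 1 := by
    have h : (o - 1) * (o * o + o + 1) = 0 := by linear_combination ho3
    have h' := (mul_eq_zero.1 h).resolve_left (sub_ne_zero.2 ho1)
    linear_combination h' - (o + 1) * h2
  have hS : ∀ i : Fin 3, QE.Syz (M i.succ) (M i.castSucc) := by
    intro i
    obtain ⟨P, hP, _, f, g, w, hs⟩ := hseq i
    exact ⟨P, f, g, w, (QE.projective_iff P).1 hP, hs⟩
  have hfdS : ∀ i : Fin 3, FiniteDimensional k (M i.succ).V := by
    intro i
    obtain ⟨P, hP, hfd, f, g, w, hs⟩ := hseq i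
    exact FiniteDimensional.of_injective (QE.lin f) (QE.shortExact_iff.1 hs).1
  obtain ⟨i0⟩ := hM0
  have hfd0 : FiniteDimensional k (M 0).V := by
    haveI : FiniteDimensional k (Rep.trivial k G k).V := inferInstanceAs (FiniteDimensional k k)
    exact FiniteDimensional.of_injective (QE.lin i0.hom) (QE.inj_of_mono i0.hom)
  have s0 : QE.Syz (M 1) (M 0) := hS 0
  have s1 : QE.Syz (M 2) (M 1) := hS 1
  have s2 : QE.Syz (M 3) (M 2) := hS 2
  have e0 : QE.SEq (M 0) (Rep.trivial k G k) := QE.SEq.of_iso i0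
  have e1 : QE.SEq (M 1) (QE.JJ k G) := s0.seq_down (QE.syzJ k G) e0
  have e2 : QE.SEq (M 2) (QE.RR (k := k) e) := s1.seq_down (QE.syzR e) e1
  have t0 : QE.tyK e (M 0) := (QE.tyK_triv e).seq e0.symm
  have t1 : QE.tyO e (M 1) := s0.tyK_tyO t0
  have t2 : QE.tyK e (M 2) := s1.tyO_tyK t1
  have t3 : QE.tyO e (M 3) := s2.tyK_tyO t2
  have n02 : ¬ QE.SEq (M 2) (M 0) := fun h => QE.R_ne_k e (e2.symm.trans (h.trans e0))
  have n13 : ¬ QE.SEq (M 3) (M 1) := fun h => n02 (s2.seq_up s0 h)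
  have nKO : ∀ {A B : Rep.{0} k G}, QE.tyK e A → QE.tyO e B → ¬ QE.SEq A B :=
    fun a b h => (a.seq h).not_tyO b
  have nOK : ∀ {A B : Rep.{0} k G}, QE.tyO e A → QE.tyK e B → ¬ QE.SEq A B :=
    fun a b h => b.not_tyO (a.seq h)
  have tL := QE.L5_ty e ho
  simp only [QE.stablyIso_iff]
  refine ⟨?_, ?_, QE.L5 e ho, QE.endotrivial_of_E1 (e := e) ho (QE.L5_fd e ho) tL.E1, QE.L5_sq e ho, ?_, ?_⟩
  · intro i
    fin_cases i
    · exact QE.endotrivial_of_E1 (e := e) ho hfd0 t0.E1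
    · exact QE.endotrivial_of_E1 (e := e) ho (hfdS 0) t1.E1
    · exact QE.endotrivial_of_E1 (e := e) ho (hfdS 1) t2.E1
    · exact QE.endotrivial_of_E1 (e := e) ho (hfdS 2) t3.E1
  · intro i j hij
    fin_cases i <;> fin_cases j <;>
      first
      | exact (hij rfl).elim
      | exact nKO t0 t1
      | exact nKO t0 t3
      | exact nKO t2 t1
      | exact nKO t2 t3
      | exact nOK t1 t0
      | exact nOK t3 t0
      | exact nOK t1 t2
      | exact nOK t3 t2
      | exact n02
      | exact n13
      | exact fun h => n02 h.symm
      | exact fun h => n13 h.symm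
  · intro i
    fin_cases i
    · exact fun h => QE.L_ne_k e ho (h.trans e0)
    · exact nKO tL t1
    · exact fun h => QE.R_ne_L e ho (e2.symm.trans h.symm)
    · exact nKO tL t3
  · intro N hN
    rcases QE.cls_all e ho N hN e0 s0 s1 s2 with h | h | h | h
    · exact ⟨0, h⟩
    · exact ⟨1, h⟩
    · exact ⟨2, h⟩
    · exact ⟨3, h⟩
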